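/- arXiv:1207.1789 — 5 statements merged into one kernel-verified Lean document; each statement's English description precedes it below -/
import Mathlib

section
/- Let I_1, I_2 be ideals in a commutative Noetherian local ring (R, m) such that depth(R/I_1) ≥ depth(R/I_2) > depth(R/(I_1+I_2)). Then depth(R/(I_1 ∩ I_2)) = 1 + depth(R/(I_1+I_2)). -/
open MvPolynomial

noncomputable section

/-- The depth of the `R`-module `M` over the local ring `(R, 𝔪)`: the supremum of the
lengths of `M`-regular sequences consisting of elements of the maximal ideal. -/
noncomputable def localDepth (R : Type*) [CommRing R] [IsLocalRing R]
    (M : Type*) [AddCommGroup M] [Module R M] : ℕ :=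
  sSup {k : ℕ | ∃ rs : List R, rs.length = k ∧ (∀ r ∈ rs, r ∈ IsLocalRing.maximalIdeal R) ∧
    RingTheory.Sequence.IsRegular M rs}

open CategoryTheory CategoryTheory.Abelian IsLocalRing

universe u

section Depth

variable {R : Type u} [CommRing R] [IsNoetherianRing R] [IsLocalRing R]

/-- The lengths of regular sequences on a finite module are bounded by its dimension. -/
lemma bddAbove_length_isRegular (M : Type u) [AddCommGroup M] [Module R M] [Module.Finite R M] :
    BddAbove {k : ℕ | ∃ rs : List R, rs.length = k ∧ (∀ r ∈ rs, r ∈ maximalIdeal R) ∧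
      RingTheory.Sequence.IsRegular M rs} := by
  obtain ⟨d, hd⟩ : ∃ d : ℕ, ringKrullDim R ≤ d := by
    obtain ⟨e, he⟩ := WithBot.ne_bot_iff_exists.mp (ringKrullDim_ne_bot (R := R))
    have hne : e ≠ ⊤ := by
      rintro rfl
      exact ringKrullDim_ne_top (R := R) he.symm
    obtain ⟨d, rfl⟩ := ENat.ne_top_iff_exists.mp hne
    exact ⟨d, he.ge⟩
  refine ⟨d, ?_⟩
  rintro _ ⟨rs, rfl, -, hrs⟩
  have hnt := hrs.quot_ofList_smul_nontrivial ⊤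
  have h := Module.supportDim_add_length_eq_supportDim_of_isRegular rs hrs
  have h0 : 0 ≤ Module.supportDim R (M ⧸ Ideal.ofList rs • (⊤ : Submodule R M)) := by
    have := Module.nonempty_support_of_nontrivial (R := R)
      (M := M ⧸ Ideal.ofList rs • (⊤ : Submodule R M))
    have := this.to_subtype
    exact Order.krullDim_nonneg
  have : ((rs.length : ℕ) : WithBot ℕ∞) ≤ d := by
    calc ((rs.length : ℕ) : WithBot ℕ∞) = 0 + rs.length := (zero_add _).symm
      _ ≤ _ := add_le_add_left h0 _
      _ = _ := h
      _ ≤ _ := Module.supportDim_le_ringKrullDim R M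
      _ ≤ d := hd
  exact_mod_cast this

/-- The characterization of depth through the vanishing of `Ext` from the residue field. -/
lemma le_localDepth_iff (M : Type u) [AddCommGroup M] [Module R M] [Module.Finite R M]
    [Nontrivial M] (n : ℕ) :
    n ≤ localDepth R M ↔ ∀ i < n, Subsingleton
      (Ext (ModuleCat.of R (Shrink.{u} (R ⧸ maximalIdeal R))) (ModuleCat.of R M) i) := by
  have key (k : ℕ) := (ModuleCat.exists_isRegular_tfae (maximalIdeal R) k (ModuleCat.of R M)
    (Submodule.top_ne_ideal_smul_of_le_jacobson_annihilator
      (maximalIdeal_le_jacobson _)).symm.lt_top).out 1 3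
  refine ⟨fun hn i hi ↦ ?_, fun h ↦ le_csSup (bddAbove_length_isRegular M) ((key n).mp h)⟩
  have hne : {k : ℕ | ∃ rs : List R, rs.length = k ∧ (∀ r ∈ rs, r ∈ maximalIdeal R) ∧
      RingTheory.Sequence.IsRegular M rs}.Nonempty := ⟨0, [], rfl, by simp, .nil R M⟩
  exact (key (localDepth R M)).mpr (Nat.sSup_mem hne (bddAbove_length_isRegular M))
    i (hi.trans_le hn)

variable {K M N L : Type u} [AddCommGroup K] [Module R K] [Module.Finite R K] [Nontrivial K]
  [AddCommGroup M] [Module R M] [Module.Finite R M] [Nontrivial M]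
  [AddCommGroup N] [Module R N] [Module.Finite R N] [Nontrivial N]
  [AddCommGroup L] [Module R L] [Module.Finite R L] [Nontrivial L]

lemma le_localDepth_prod {n : ℕ} (hM : n ≤ localDepth R M) (hN : n ≤ localDepth R N) :
    n ≤ localDepth R (M × N) := by
  rw [le_localDepth_iff] at hM hN ⊢
  intro i hi
  have hS := ModuleCat.shortComplex_shortExact
    (ModuleCat.shortComplexOfCompEqZero (LinearMap.inl R M N) (LinearMap.snd R M N)
      (by ext; simp)) Function.Exact.inl_snd LinearMap.inl_injective LinearMap.snd_surjective
  have := hM i hi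
  have := hN i hi
  refine subsingleton_of_forall_eq 0 fun x ↦ ?_
  obtain ⟨y, rfl⟩ := Ext.covariant_sequence_exact₂ _ hS x (Subsingleton.elim (α := Ext _ _ i) _ _)
  rw [show y = 0 from Subsingleton.elim (α := Ext _ _ i) _ _, Ext.zero_comp]

/-- The depth lemma, when the depth of the cokernel is less than that of the middle term. -/
lemma localDepth_eq_one_add_of_exact {f : K →ₗ[R] M} {g : M →ₗ[R] L}
    (hfg : Function.Exact f g) (hf : Function.Injective f) (hg : Function.Surjective g)
    (h : localDepth R L < localDepth R M) : localDepth R K = 1 + localDepth R L := by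
  have hS := ModuleCat.shortComplex_shortExact
    (ModuleCat.shortComplexOfCompEqZero f g hfg.linearMap_comp_eq_zero) hfg hf hg
  have hM := (le_localDepth_iff (R := R) M _).mp le_rfl
  have hL := (le_localDepth_iff (R := R) L _).mp le_rfl
  apply le_antisymm
  · by_contra! hK
    have hK' := (le_localDepth_iff (R := R) K _).mp le_rfl
    refine (Nat.lt_succ_self (localDepth R L)).not_ge ((le_localDepth_iff L _).mpr fun i hi ↦ ?_)
    have := hM i (by omega)
    have := hK' (i + 1) (by omega)
    refine subsingleton_of_forall_eq 0 fun x ↦ ?_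
    obtain ⟨y, rfl⟩ := Ext.covariant_sequence_exact₃ _ hS x rfl
      (Subsingleton.elim (α := Ext _ _ (i + 1)) _ _)
    rw [show y = 0 from Subsingleton.elim (α := Ext _ _ i) _ _, Ext.zero_comp]
  · rw [le_localDepth_iff]
    intro i hi
    have := hM i (by omega)
    refine subsingleton_of_forall_eq 0 fun x ↦ ?_
    cases i with
    | zero =>
      have : Mono (ModuleCat.ofHom f) := hS.mono_f
      exact Ext.postcomp_mk₀_injective_of_mono _ (ModuleCat.ofHom f)
        (Subsingleton.elim (α := Ext _ (ModuleCat.of R M) 0) _ _)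
    | succ i =>
      have := hL i (by omega)
      obtain ⟨y, rfl⟩ := Ext.covariant_sequence_exact₁ _ hS x
        (Subsingleton.elim (α := Ext _ _ (i + 1)) _ _) rfl
      rw [show y = 0 from Subsingleton.elim (α := Ext _ _ i) _ _, Ext.zero_comp]

end Depth

lemma localDepth_eq_zero_of_subsingleton (R : Type*) [CommRing R] [IsLocalRing R] (M : Type*)
    [AddCommGroup M] [Module R M] [Subsingleton M] : localDepth R M = 0 := by
  have : {k : ℕ | ∃ rs : List R, rs.length = k ∧ (∀ r ∈ rs, r ∈ maximalIdeal R) ∧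
      RingTheory.Sequence.IsRegular M rs} = ∅ := by
    ext k
    simp only [Set.mem_ofPred_eq, Set.mem_empty_iff_false, iff_false]
    rintro ⟨rs, -, -, hrs⟩
    exact not_subsingleton_iff_nontrivial.mpr hrs.nontrivial ‹_›
  rw [localDepth, this, csSup_empty, bot_eq_zero]

/-- Let `I₁, I₂` be ideals in a commutative Noetherian local ring `(R, 𝔪)`
with `depth R/I₁ ≥ depth R/I₂ > depth R/(I₁+I₂)`.  Then
`depth R/(I₁ ∩ I₂) = 1 + depth R/(I₁+I₂)`. -/
theorem depth_inf_eq_succ_depth_sum {R : Type*} [CommRing R] [IsNoetherianRing R]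
    [IsLocalRing R] (I₁ I₂ : Ideal R)
    (h₁ : localDepth R (R ⧸ I₂) ≤ localDepth R (R ⧸ I₁))
    (h₂ : localDepth R (R ⧸ (I₁ + I₂)) < localDepth R (R ⧸ I₂)) :
    localDepth R (R ⧸ (I₁ ⊓ I₂)) = 1 + localDepth R (R ⧸ (I₁ + I₂)) := by
  have proper {I : Ideal R} (h : 0 < localDepth R (R ⧸ I)) : I ≠ ⊤ := by
    rintro rfl
    have : Subsingleton (R ⧸ (⊤ : Ideal R)) := Ideal.Quotient.subsingleton_iff.mpr rfl
    exact h.ne' (localDepth_eq_zero_of_subsingleton R _)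
  have hI₁ : I₁ ≠ ⊤ := proper (by omega)
  have hI₂ : I₂ ≠ ⊤ := proper (by omega)
  have hsum : I₁ + I₂ ≠ ⊤ := ne_top_of_le_ne_top (maximalIdeal.isMaximal R).ne_top
    (sup_le (le_maximalIdeal hI₁) (le_maximalIdeal hI₂))
  have hinf : I₁ ⊓ I₂ ≠ ⊤ := ne_top_of_le_ne_top hI₁ inf_le_left
  have := Ideal.Quotient.nontrivial_iff.mpr hI₁
  have := Ideal.Quotient.nontrivial_iff.mpr hI₂
  have := Ideal.Quotient.nontrivial_iff.mpr hsum
  have := Ideal.Quotient.nontrivial_iff.mpr hinf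
  let f : (R ⧸ (I₁ ⊓ I₂)) →ₗ[R] (R ⧸ I₁) × (R ⧸ I₂) :=
    (Submodule.factor inf_le_left).prod (Submodule.factor inf_le_right)
  let g : (R ⧸ I₁) × (R ⧸ I₂) →ₗ[R] R ⧸ (I₁ + I₂) :=
    (Submodule.factor (le_sup_left : I₁ ≤ I₁ ⊔ I₂)).coprod
      (-Submodule.factor (le_sup_right : I₂ ≤ I₁ ⊔ I₂))
  have hg : Function.Surjective g := fun z ↦ by
    obtain ⟨z, rfl⟩ := Submodule.mkQ_surjective _ z
    exact ⟨(Submodule.Quotient.mk z, 0), by simp [g]⟩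
  have hf : Function.Injective f := by
    rw [← LinearMap.ker_eq_bot, LinearMap.ker_eq_bot']
    intro z hz
    obtain ⟨z, rfl⟩ := Submodule.mkQ_surjective _ z
    have hz' : (Submodule.Quotient.mk z : R ⧸ I₁) = 0 ∧ (Submodule.Quotient.mk z : R ⧸ I₂) = 0 :=
      Prod.ext_iff.mp hz
    rw [Submodule.Quotient.mk_eq_zero, Submodule.Quotient.mk_eq_zero] at hz'
    exact (Submodule.Quotient.mk_eq_zero _).mpr hz'
  have hfg : Function.Exact f g := by
    rintro ⟨x, y⟩
    obtain ⟨x, rfl⟩ := Submodule.mkQ_surjective _ x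
    obtain ⟨y, rfl⟩ := Submodule.mkQ_surjective _ y
    constructor
    · intro h
      have h' : (Submodule.Quotient.mk (x - y) : R ⧸ (I₁ ⊔ I₂)) = 0 := by
        rw [Submodule.Quotient.mk_sub, sub_eq_add_neg]
        exact h
      rw [Submodule.Quotient.mk_eq_zero] at h'
      obtain ⟨a, ha, b, hb, hab⟩ := Submodule.mem_sup.mp h'
      refine ⟨Submodule.Quotient.mk (x - a), Prod.ext ?_ ?_⟩
      · refine (Submodule.Quotient.eq I₁).mpr ?_
        simpa using ha
      · refine (Submodule.Quotient.eq I₂).mpr ?_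
        rwa [LinearMap.id_apply, show x - a - y = b by linear_combination -hab]
    · rintro ⟨z, hz⟩
      obtain ⟨z, rfl⟩ := Submodule.mkQ_surjective _ z
      rw [← hz]
      exact add_neg_cancel (Submodule.Quotient.mk z : R ⧸ (I₁ ⊔ I₂))
  exact localDepth_eq_one_add_of_exact hfg hf hg
    (h₂.trans_le (le_localDepth_prod h₁ le_rfl))
end
end

section
/- Let I, I_1, I_2 be ideals in a commutative Noetherian local ring (R, m) with I = I_1 + I_2, and set r := depth(R/(I_1 ∩ I_2)). If r ≤ depth(R/I_2), then for all i < r − 1 there is an isomorphism of local cohomology modules H^i_m(R/I_1) ≅ H^i_m(R/I). -/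
open MvPolynomial

noncomputable section

open CategoryTheory Limits Opposite

universe u

section ExtIso

variable {R : Type u} [CommRing R]

lemma isZero_homology_linearYoneda_rightOp {N Y : ModuleCat.{u} R} (P : ProjectiveResolution N)
    (n : ℕ) (h : Subsingleton (Abelian.Ext N Y n)) :
    IsZero (((((linearYoneda R (ModuleCat.{u} R)).obj Y).rightOp.mapHomologicalComplex
      (ComplexShape.down ℕ)).obj P.complex).homology n) := by
  rw [← HomologicalComplex.exactAt_iff_isZero_homology]
  cases n with
  | zero =>
    rw [HomologicalComplex.exactAt_iff' _ 1 0 0 (by simp) (by simp),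
      ← ShortComplex.exact_unop_iff, ShortComplex.moduleCat_exact_iff]
    intro (f : P.complex.X 0 ⟶ Y) (hf : P.complex.d 1 0 ≫ f = 0)
    have : Subsingleton (N ⟶ Y) := Abelian.Ext.addEquiv₀.symm.subsingleton
    obtain ⟨g, hg⟩ := CokernelCofork.IsColimit.desc' P.isColimitCokernelCofork f hf
    have hg₀ : g = 0 := this.elim g 0
    have hf₀ : f = 0 := by rw [← hg, hg₀, comp_zero]
    exact ⟨0, (map_zero _).trans hf₀.symm⟩
  | succ n =>
    rw [HomologicalComplex.exactAt_iff' _ (n + 2) (n + 1) n (by simp) (by simp),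
      ← ShortComplex.exact_unop_iff, ShortComplex.moduleCat_exact_iff]
    intro (f : P.complex.X (n + 1) ⟶ Y) (hf : P.complex.d (n + 2) (n + 1) ≫ f = 0)
    exact (P.extMk_eq_zero_iff f (n + 2) rfl hf n rfl).mp (Subsingleton.elim _ _)

lemma isIso_Ext_map_of_subsingleton {S : ShortComplex (ModuleCat.{u} R)} (hS : S.ShortExact)
    (N : ModuleCat.{u} R) (i : ℕ) (h₀ : Subsingleton (Abelian.Ext N S.X₁ i))
    (h₁ : Subsingleton (Abelian.Ext N S.X₁ (i + 1))) :
    IsIso (((_root_.Ext R (ModuleCat.{u} R) i).obj (op N)).map S.g) := by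
  let P := projectiveResolution N
  let T : ShortComplex (ChainComplex (ModuleCat.{u} R)ᵒᵖ ℕ) :=
    ShortComplex.mk
      ((NatTrans.mapHomologicalComplex
        (NatTrans.rightOp ((linearYoneda R (ModuleCat.{u} R)).map S.g)) _).app P.complex)
      ((NatTrans.mapHomologicalComplex
        (NatTrans.rightOp ((linearYoneda R (ModuleCat.{u} R)).map S.f)) _).app P.complex) (by
      ext j
      apply Quiver.Hom.unop_inj
      ext (f : P.complex.X j ⟶ S.X₁)
      change (f ≫ S.f) ≫ S.g = 0
      simp)
  have hT : T.ShortExact := by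
    apply HomologicalComplex.shortExact_of_degreewise_shortExact
    intro j
    have := hS.mono_f
    have := hS.epi_g
    suffices h : (T.map (HomologicalComplex.eval _ _ j)).unop.ShortExact from h.op
    refine { exact := ?_, mono_f := ?_, epi_g := ?_ }
    · rw [ShortComplex.moduleCat_exact_iff]
      intro (f : P.complex.X j ⟶ S.X₂) (hf : f ≫ S.g = 0)
      exact ⟨hS.exact.lift f hf, hS.exact.lift_f f hf⟩
    · rw [ModuleCat.mono_iff_injective]
      intro (f : P.complex.X j ⟶ S.X₁) (g : P.complex.X j ⟶ S.X₁) (h : f ≫ S.f = g ≫ S.f)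
      exact (cancel_mono S.f).mp h
    · rw [ModuleCat.epi_iff_surjective]
      intro (f : P.complex.X j ⟶ S.X₃)
      exact ⟨Projective.factorThru f S.g, Projective.factorThru_comp f S.g⟩
  have : IsIso (HomologicalComplex.homologyMap T.f i) := by
    have hm : Mono (HomologicalComplex.homologyMap T.f i) :=
      (hT.homology_exact₁ (i + 1) i rfl).mono_g
        ((isZero_homology_linearYoneda_rightOp P (i + 1) h₁).eq_of_src _ _)
    have he : Epi (HomologicalComplex.homologyMap T.f i) :=
      (hT.homology_exact₂ i).epi_f
        ((isZero_homology_linearYoneda_rightOp P i h₀).eq_of_tgt _ _)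
    exact isIso_of_mono_of_epi _
  have h : IsIso ((NatTrans.leftDerived
      (NatTrans.rightOp ((linearYoneda R (ModuleCat.{u} R)).map S.g)) i).app N) := by
    rw [P.leftDerived_app_eq]
    change IsIso (_ ≫ HomologicalComplex.homologyMap T.f i ≫ _)
    exact IsIso.comp_isIso' (Iso.isIso_hom _) (IsIso.comp_isIso' this (Iso.isIso_inv _))
  change IsIso (Quiver.Hom.unop ((NatTrans.leftDerived
      (NatTrans.rightOp ((linearYoneda R (ModuleCat.{u} R)).map S.g)) i).app N))
  infer_instance

end ExtIso

lemma localCohomology.nonempty_iso_of_isIso_Ext_map {R : Type u} [CommRing R] (J : Ideal R) (i : ℕ)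
    {X Y : ModuleCat.{u} R} (f : X ⟶ Y)
    (h : ∀ t : ℕ, IsIso (((_root_.Ext R (ModuleCat.{u} R) i).obj
      (op (ModuleCat.of R (R ⧸ J ^ t)))).map f)) :
    Nonempty ((localCohomology J i).obj X ≅ (localCohomology J i).obj Y) := by
  let F := localCohomology.diagram (localCohomology.idealPowersDiagram J) i
  let α : F ⋙ (evaluation _ _).obj X ⟶ F ⋙ (evaluation _ _).obj Y :=
    Functor.whiskerLeft F ((evaluation _ _).map f)
  have h' (t) : IsIso (α.app t) := h (unop (unop t))
  have : IsIso α := NatIso.isIso_of_isIso_app α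
  exact ⟨colimitObjIsoColimitCompEvaluation F X ≪≫ HasColimit.isoOfNatIso (asIso α) ≪≫
    (colimitObjIsoColimitCompEvaluation F Y).symm⟩

section Depth

variable {R : Type u} [CommRing R]

lemma subsingleton_ext_left_of_shortExact {S : ShortComplex (ModuleCat.{u} R)} (hS : S.ShortExact)
    (N : ModuleCat.{u} R) (n : ℕ) (h₂ : ∀ i < n, Subsingleton (Abelian.Ext N S.X₂ i))
    (h₃ : ∀ i < n, Subsingleton (Abelian.Ext N S.X₃ i)) (i : ℕ) (hi : i < n) :
    Subsingleton (Abelian.Ext N S.X₁ i) := by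
  have := h₂ i hi
  cases i with
  | zero =>
    have := hS.mono_f
    exact (Abelian.Ext.postcomp_mk₀_injective_of_mono N S.f).subsingleton
  | succ i =>
    have := h₃ i (by lia)
    refine subsingleton_of_forall_eq 0 fun x ↦ ?_
    obtain ⟨y, rfl⟩ := Abelian.Ext.covariant_sequence_exact₁ N hS x (Subsingleton.elim _ _) rfl
    simp [Subsingleton.elim y 0]

lemma support_quotient_pow_subset_zeroLocus (J : Ideal R) (t : ℕ) :
    Module.support R (R ⧸ J ^ t) ⊆ PrimeSpectrum.zeroLocus J := by
  rw [Module.support_eq_zeroLocus, Ideal.annihilator_quotient]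
  intro p hp
  exact p.isPrime.le_of_pow_le hp

lemma subsingleton_ext_of_lt_localDepth [IsNoetherianRing R] [IsLocalRing R]
    (M : Type u) [AddCommGroup M] [Module R M] [Module.Finite R M] (t i : ℕ)
    (hi : i < localDepth R M) :
    Subsingleton (Abelian.Ext
      (ModuleCat.of R (R ⧸ IsLocalRing.maximalIdeal R ^ t)) (ModuleCat.of R M) i) := by
  have hpos : 0 < localDepth R M := by lia
  obtain ⟨rs, hlen, hmem, hreg⟩ := Nat.sSup_mem
    (Set.nonempty_iff_ne_empty.mpr fun h ↦ hpos.ne' ((congrArg sSup h).trans csSup_empty))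
    (by_contra fun h ↦ hpos.ne' (Nat.sSup_of_not_bddAbove h))
  have := hreg.nontrivial
  have hlt : IsLocalRing.maximalIdeal R • (⊤ : Submodule R M) < ⊤ := by
    refine lt_top_iff_ne_top.mpr (Ne.symm ?_)
    exact Submodule.top_ne_ideal_smul_of_le_jacobson_annihilator
      (IsLocalRing.maximalIdeal_le_jacobson _)
  exact ModuleCat.subsingleton_ext_of_exists_isRegular _ _
    (support_quotient_pow_subset_zeroLocus _ t) (ModuleCat.of R M) hlt rs hmem hreg i
      (hi.trans_eq hlen.symm)

end Depth

section Quotient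

variable {R : Type u} [CommRing R] (I₁ I₂ : Ideal R)

/-- The kernel of `R ⧸ (I₁ ⊓ I₂) → R ⧸ I₂` included in `R ⧸ (I₁ ⊓ I₂)`, as a short complex. -/
def infFactorShortComplex : ShortComplex (ModuleCat.{u} R) :=
  ShortComplex.mk (X₂ := ModuleCat.of R (R ⧸ (I₁ ⊓ I₂))) (X₃ := ModuleCat.of R (R ⧸ I₂))
    (ModuleCat.ofHom (LinearMap.ker (Submodule.factor (inf_le_right : I₁ ⊓ I₂ ≤ I₂))).subtype)
    (ModuleCat.ofHom (Submodule.factor inf_le_right)) (by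
      ext x
      exact x.2)

/-- The kernel of `R ⧸ (I₁ ⊓ I₂) → R ⧸ I₂`, mapped to `R ⧸ I₁` and identified with the kernel of
`R ⧸ I₁ → R ⧸ (I₁ ⊔ I₂)`, as a short complex. -/
def supFactorShortComplex : ShortComplex (ModuleCat.{u} R) :=
  ShortComplex.mk (X₂ := ModuleCat.of R (R ⧸ I₁)) (X₃ := ModuleCat.of R (R ⧸ (I₁ ⊔ I₂)))
    (ModuleCat.ofHom (Submodule.factor inf_le_left ∘ₗ
      (LinearMap.ker (Submodule.factor (inf_le_right : I₁ ⊓ I₂ ≤ I₂))).subtype))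
    (ModuleCat.ofHom (Submodule.factor le_sup_left)) (by
      ext ⟨x, hx⟩
      obtain ⟨x, rfl⟩ := Submodule.Quotient.mk_surjective _ x
      have hx : x ∈ I₂ := (Submodule.Quotient.mk_eq_zero _).mp hx
      exact (Submodule.Quotient.mk_eq_zero _).mpr (le_sup_right (a := I₁) hx))

lemma infFactorShortComplex_shortExact : (infFactorShortComplex I₁ I₂).ShortExact where
  exact := by
    rw [ShortComplex.moduleCat_exact_iff]
    exact fun x hx ↦ ⟨⟨x, hx⟩, rfl⟩
  mono_f := (ModuleCat.mono_iff_injective _).mpr Subtype.val_injective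
  epi_g := (ModuleCat.epi_iff_surjective _).mpr (Submodule.factor_surjective (by simp))

lemma supFactorShortComplex_shortExact : (supFactorShortComplex I₁ I₂).ShortExact where
  exact := by
    rw [ShortComplex.moduleCat_exact_iff]
    intro (x : R ⧸ I₁) hx
    obtain ⟨x, rfl⟩ := Submodule.Quotient.mk_surjective _ x
    obtain ⟨a, ha, b, hb, rfl⟩ := Submodule.mem_sup.mp ((Submodule.Quotient.mk_eq_zero _).mp hx)
    refine ⟨⟨Submodule.Quotient.mk b, (Submodule.Quotient.mk_eq_zero _).mpr hb⟩, ?_⟩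
    refine (Submodule.Quotient.eq I₁).mpr ?_
    simpa using ha
  mono_f := by
    rw [ModuleCat.mono_iff_injective]
    refine (injective_iff_map_eq_zero (supFactorShortComplex I₁ I₂).f.hom).mpr ?_
    rintro ⟨x, hx⟩ h
    obtain ⟨x, rfl⟩ := Submodule.Quotient.mk_surjective _ x
    have hx₂ : x ∈ I₂ := (Submodule.Quotient.mk_eq_zero _).mp hx
    have hx₁ : x ∈ I₁ := (Submodule.Quotient.mk_eq_zero _).mp h
    exact Subtype.ext ((Submodule.Quotient.mk_eq_zero _).mpr ⟨hx₁, hx₂⟩)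
  epi_g := (ModuleCat.epi_iff_surjective _).mpr (Submodule.factor_surjective (by simp))

end Quotient

/-- Let `I, I₁, I₂` be ideals in a commutative Noetherian local ring
`(R, 𝔪)` with `I = I₁ + I₂`, and set `r := depth R/(I₁ ∩ I₂)`.  If `r ≤ depth R/I₂`,
then for all `i < r - 1` there is an isomorphism `H^i_𝔪(R/I₁) ≅ H^i_𝔪(R/I)` of local
cohomology modules. -/
theorem localCohomology_iso_of_depth {R : Type} [CommRing R] [IsNoetherianRing R]
    [IsLocalRing R] (I I₁ I₂ : Ideal R) (hI : I = I₁ + I₂)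
    (hr : localDepth R (R ⧸ (I₁ ⊓ I₂)) ≤ localDepth R (R ⧸ I₂)) :
    ∀ i : ℕ, i < localDepth R (R ⧸ (I₁ ⊓ I₂)) - 1 →
      Nonempty
        ((localCohomology (IsLocalRing.maximalIdeal R) i).obj
            (ModuleCat.of R (R ⧸ I₁)) ≅
          (localCohomology (IsLocalRing.maximalIdeal R) i).obj
            (ModuleCat.of R (R ⧸ I))) := by
  subst hI
  intro i hi
  refine localCohomology.nonempty_iso_of_isIso_Ext_map _ i (supFactorShortComplex I₁ I₂).g
    fun t ↦ ?_
  have hK := subsingleton_ext_left_of_shortExact (infFactorShortComplex_shortExact I₁ I₂)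
    (ModuleCat.of R (R ⧸ IsLocalRing.maximalIdeal R ^ t)) (localDepth R (R ⧸ (I₁ ⊓ I₂)))
    (fun j hj ↦ subsingleton_ext_of_lt_localDepth _ t j hj)
    (fun j hj ↦ subsingleton_ext_of_lt_localDepth _ t j (hj.trans_le hr))
  exact isIso_Ext_map_of_subsingleton (supFactorShortComplex_shortExact I₁ I₂) _ i
    (hK i (by lia)) (hK (i + 1) (by lia))
end
end

section
/- Let n ≥ 3 and S = K[x_1,…,x_n]. For j = 2,…,n let m_j = ∏_{2 ≤ i ≤ n, i ≠ j} x_i. Then T'_{1,n} := ∩_{2 ≤ i < j ≤ n} (x_i, x_j) equals the ideal (m_2,…,m_n), and T_{1,n} := ∩_{2 ≤ i < j ≤ n} (x_1, x_i, x_j) equals the ideal (x_1, m_2,…,m_n). -/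
open MvPolynomial

noncomputable section


/-- Membership in an ideal generated by squarefree monomials can be tested on the support. -/
theorem mem_span_prod_X_image {σ R : Type*} [CommSemiring R] (F : Set (Finset σ))
    (p : MvPolynomial σ R) :
    p ∈ Ideal.span ((fun s : Finset σ => ∏ i ∈ s, (X i : MvPolynomial σ R)) '' F) ↔
      ∀ m ∈ p.support, ∃ s ∈ F, ∀ i ∈ s, m i ≠ 0 := by
  classical
  have h_image : (fun s : Finset σ => ∏ i ∈ s, (X i : MvPolynomial σ R)) '' F =
      (fun d => monomial d (1 : R)) '' ((fun s => ∑ i ∈ s, Finsupp.single i 1) '' F) := by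
    rw [Set.image_image]
    refine Set.image_congr fun s _ => ?_
    simp [X, monomial_sum_one]
  have h_le (s : Finset σ) (m : σ →₀ ℕ) :
      ∑ i ∈ s, Finsupp.single i 1 ≤ m ↔ ∀ i ∈ s, m i ≠ 0 := by
    have h_apply (a : σ) :
        (∑ i ∈ s, Finsupp.single i 1 : σ →₀ ℕ) a = if a ∈ s then 1 else 0 := by
      simp [Finsupp.finsetSum_apply, Finsupp.single_apply]
    simp only [Finsupp.le_def, h_apply]
    refine forall_congr' fun a => ?_
    split_ifs with ha <;> simp [ha, Nat.one_le_iff_ne_zero]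
  rw [h_image, mem_ideal_span_monomial_image]
  simp only [Set.exists_mem_image, h_le]

theorem forall_lt_or_iff_exists_forall_ne {n : ℕ} (hn : 2 ≤ n) (P : Fin n → Prop) :
    (∀ i j : Fin n, 0 < (i : ℕ) → i < j → P i ∨ P j) ↔
      ∃ j : Fin n, 0 < (j : ℕ) ∧ ∀ i : Fin n, 0 < (i : ℕ) → i ≠ j → P i := by
  constructor
  · intro h
    by_cases h_all : ∀ i : Fin n, 0 < (i : ℕ) → P i
    · exact ⟨⟨1, hn⟩, Nat.one_pos, fun i hi _ => h_all i hi⟩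
    · push Not at h_all
      obtain ⟨j, hj, hPj⟩ := h_all
      refine ⟨j, hj, fun i hi hij => ?_⟩
      rcases lt_or_gt_of_ne hij with hlt | hgt
      · exact (h i j hi hlt).resolve_right hPj
      · exact (h j i hj hgt).resolve_left hPj
  · rintro ⟨j, _, h⟩ a b ha hab
    by_cases haj : a = j
    · exact Or.inr (h b (ha.trans hab) (haj ▸ hab.ne'))
    · exact Or.inl (h a ha haj)

/-- In `S = K[x₁,…,xₙ]` (`n ≥ 3`), with `mⱼ = ∏_{2 ≤ i ≤ n, i ≠ j} xᵢ`,
one has `T'_{1,n} := ⋂_{2 ≤ i < j ≤ n} (xᵢ, xⱼ) = (m₂, …, mₙ)` and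
`T_{1,n} := ⋂_{2 ≤ i < j ≤ n} (x₁, xᵢ, xⱼ) = (x₁, m₂, …, mₙ)`.
(Variables are indexed so that `x_k = X ⟨k-1⟩`.) -/
theorem T1n_eq_span {K : Type*} [Field K] (n : ℕ) (hn : 3 ≤ n) :
    (⨅ (i : Fin n) (j : Fin n) (_ : 0 < (i : ℕ)) (_ : i < j),
        Ideal.span {(X i : MvPolynomial (Fin n) K), X j}) =
      Ideal.span ((fun j : Fin n =>
        ∏ i ∈ Finset.univ.filter (fun i : Fin n => 0 < (i : ℕ) ∧ i ≠ j),
          (X i : MvPolynomial (Fin n) K)) '' {j : Fin n | 0 < (j : ℕ)}) ∧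
    (⨅ (i : Fin n) (j : Fin n) (_ : 0 < (i : ℕ)) (_ : i < j),
        Ideal.span {(X (⟨0, by omega⟩ : Fin n) : MvPolynomial (Fin n) K), X i, X j}) =
      Ideal.span ({X (⟨0, by omega⟩ : Fin n)} ∪
        (fun j : Fin n =>
          ∏ i ∈ Finset.univ.filter (fun i : Fin n => 0 < (i : ℕ) ∧ i ≠ j),
            (X i : MvPolynomial (Fin n) K)) '' {j : Fin n | 0 < (j : ℕ)}) := by
  have h_gen : (fun j : Fin n =>
      ∏ i ∈ Finset.univ.filter (fun i : Fin n => 0 < (i : ℕ) ∧ i ≠ j),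
        (X i : MvPolynomial (Fin n) K)) '' {j : Fin n | 0 < (j : ℕ)} =
      (fun s : Finset (Fin n) => ∏ i ∈ s, (X i : MvPolynomial (Fin n) K)) ''
        ((fun j : Fin n => Finset.univ.filter (fun i : Fin n => 0 < (i : ℕ) ∧ i ≠ j)) ''
          {j : Fin n | 0 < (j : ℕ)}) := by
    rw [Set.image_image]
  have h_pair (i j : Fin n) : ({X i, X j} : Set (MvPolynomial (Fin n) K)) = X '' {i, j} := by
    rw [Set.image_pair]
  have h_triple (i j k : Fin n) :
      ({X i, X j, X k} : Set (MvPolynomial (Fin n) K)) = X '' {i, j, k} := by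
    rw [Set.image_insert_eq, Set.image_pair]
  have h_zero (i : Fin n) : ({X i} : Set (MvPolynomial (Fin n) K)) =
      (fun s : Finset (Fin n) => ∏ i ∈ s, (X i : MvPolynomial (Fin n) K)) '' {{i}} := by
    simp
  constructor
  · ext p
    rw [h_gen, mem_span_prod_X_image]
    simp only [Submodule.mem_iInf, h_pair, mem_ideal_span_X_image, Set.exists_mem_image,
      Set.mem_ofPred_eq, Finset.mem_filter, Finset.mem_univ, true_and, and_imp,
      Set.mem_insert_iff, Set.mem_singleton_iff, exists_eq_or_imp, exists_eq_left,
      ← forall_lt_or_iff_exists_forall_ne (by omega : 2 ≤ n)]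
    exact ⟨fun h m hm i j hi hij => h i j hi hij m hm, fun h i j hi hij m hm => h m hm i j hi hij⟩
  · ext p
    rw [h_gen, h_zero, ← Set.image_union, mem_span_prod_X_image]
    simp only [Submodule.mem_iInf, h_triple, mem_ideal_span_X_image, Set.mem_union, or_and_right,
      exists_or, Set.exists_mem_image,
      Set.mem_ofPred_eq, Finset.mem_filter, Finset.mem_univ, true_and, and_imp,
      Set.mem_insert_iff, Set.mem_singleton_iff, exists_eq_left,
      Finset.mem_singleton, forall_eq,
      ← forall_lt_or_iff_exists_forall_ne (by omega : 2 ≤ n)]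
    constructor
    · intro h m hm
      by_cases h0 : m ⟨0, by omega⟩ = 0
      · exact Or.inr fun i j hi hij => (h i j hi hij m hm).resolve_left (not_not.mpr h0)
      · exact Or.inl h0
    · intro h i j hi hij m hm
      exact (h m hm).imp_right fun h' => h' i j hi hij
end
end

section
/- Let n ≥ 3 and S = K[x_1,…,x_n]. Set T'_{1,n} = ∩_{2 ≤ i < j ≤ n} (x_i, x_j) and T_{1,n} = ∩_{2 ≤ i < j ≤ n} (x_1, x_i, x_j). Then S/T'_{1,n} is Cohen–Macaulay of dimension n−2, and S/T_{1,n} is Cohen–Macaulay of dimension n−3. -/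
open MvPolynomial

noncomputable section

/-- The depth of the module `M` with respect to the ideal `J`: the supremum of the lengths
of `M`-regular sequences consisting of elements of `J`. -/
noncomputable def idealDepth {R : Type*} [CommRing R] (J : Ideal R)
    (M : Type*) [AddCommGroup M] [Module R M] : ℕ :=
  sSup {k : ℕ | ∃ rs : List R, rs.length = k ∧ (∀ r ∈ rs, r ∈ J) ∧
    RingTheory.Sequence.IsRegular M rs}

open RingTheory.Sequence

section RegularSequences

open scoped Pointwise

variable {R : Type*} [CommRing R]

theorem isWeaklyRegular_of_exact {M₁ M₂ M₃ : Type*} [AddCommGroup M₁] [Module R M₁]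
    [AddCommGroup M₂] [Module R M₂] [AddCommGroup M₃] [Module R M₃] (rs : List R)
    (f : M₁ →ₗ[R] M₂) (g : M₂ →ₗ[R] M₃) (hf : Function.Injective f)
    (hfg : Function.Exact f g) (hg : Function.Surjective g)
    (h₁ : IsWeaklyRegular M₁ rs) (h₃ : IsWeaklyRegular M₃ rs) : IsWeaklyRegular M₂ rs := by
  induction rs generalizing M₁ M₂ M₃ with
  | nil => exact .nil R M₂
  | cons r rs ih =>
    rw [isWeaklyRegular_cons_iff] at h₁ h₃ ⊢
    refine ⟨?_, ih (QuotSMulTop.map r f) (QuotSMulTop.map r g) ?_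
      (QuotSMulTop.map_exact r hfg hg) (QuotSMulTop.map_surjective r hg) h₁.2 h₃.2⟩
    · refine isSMulRegular_iff_right_eq_zero_of_smul.mpr fun x hx => ?_
      have hgx : g x = 0 := h₃.1.right_eq_zero_of_smul (by rw [← map_smul, hx, map_zero])
      obtain ⟨y, rfl⟩ := (hfg x).mp hgx
      have hy : y = 0 := h₁.1.right_eq_zero_of_smul
        (hf (by rw [map_smul, hx, map_zero]))
      rw [hy, map_zero]
    · have hex : Function.Exact (0 : M₁ →ₗ[R] M₁) f := by
        rw [LinearMap.exact_iff, LinearMap.ker_eq_bot.mpr hf, LinearMap.range_zero]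
      have := QuotSMulTop.map_first_exact_on_four_term_exact_of_isSMulRegular_last
        hex hfg h₃.1
      rw [map_zero, LinearMap.exact_iff, LinearMap.range_zero] at this
      exact LinearMap.ker_eq_bot.mp this

theorem isWeaklyRegular_quotient_of_colon (rs : List R) {I J₁ J₂ : Ideal R} (y : R)
    (h₁ : ∀ a, y * a ∈ I ↔ a ∈ J₁) (h₂ : I ⊔ Ideal.span {y} = J₂)
    (hJ₁ : IsWeaklyRegular (R ⧸ J₁) rs) (hJ₂ : IsWeaklyRegular (R ⧸ J₂) rs) :
    IsWeaklyRegular (R ⧸ I) rs := by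
  have hle : J₁ ≤ Submodule.comap (LinearMap.mulLeft R y) I := fun a ha => (h₁ a).mpr ha
  have hle' : I ≤ J₂ := h₂ ▸ le_sup_left
  refine isWeaklyRegular_of_exact rs (Submodule.mapQ J₁ I (LinearMap.mulLeft R y) hle)
    (Submodule.factor hle') ?_ ?_ (Submodule.factor_surjective hle') hJ₁ hJ₂
  · rw [← LinearMap.ker_eq_bot, LinearMap.ker_eq_bot']
    intro a ha
    obtain ⟨a, rfl⟩ := Submodule.Quotient.mk_surjective _ a
    rw [Submodule.mapQ_apply, Submodule.Quotient.mk_eq_zero] at ha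
    exact (Submodule.Quotient.mk_eq_zero _).mpr ((h₁ a).mp ha)
  · intro a
    obtain ⟨a, rfl⟩ := Submodule.Quotient.mk_surjective _ a
    constructor
    · intro ha
      have ha : a ∈ I ⊔ Ideal.span {y} := by
        rw [h₂]
        exact (Submodule.Quotient.mk_eq_zero _).mp ha
      obtain ⟨t, ht, u, hu, rfl⟩ := Submodule.mem_sup.mp ha
      obtain ⟨c, rfl⟩ := Ideal.mem_span_singleton'.mp hu
      refine ⟨Submodule.Quotient.mk c, ?_⟩
      rw [Submodule.mapQ_apply, Submodule.Quotient.eq, LinearMap.mulLeft_apply]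
      convert I.neg_mem ht using 1
      ring
    · rintro ⟨c, hc⟩
      obtain ⟨c, rfl⟩ := Submodule.Quotient.mk_surjective _ c
      rw [← hc]
      refine (Submodule.Quotient.mk_eq_zero _).mpr ?_
      rw [← h₂]
      exact Ideal.mem_sup_right (Ideal.mul_mem_right c _ (Ideal.mem_span_singleton_self y))

theorem isWeaklyRegular_of_subsingleton {M : Type*} [AddCommGroup M] [Module R M]
    [Subsingleton M] (rs : List R) : IsWeaklyRegular M rs := by
  rw [isWeaklyRegular_iff]
  intro i hi x y _
  exact (Submodule.mkQ_surjective _).subsingleton.elim x y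

theorem isWeaklyRegular_shift {M : Type*} [AddCommGroup M] [Module R M] (d : ℕ) (a : ℕ → R)
    (z : R) (ha : ∀ m : M, a 0 • m = 0)
    (h : IsWeaklyRegular M ((List.range d).map fun i => a (i + 1) - z * a i)) :
    IsWeaklyRegular M ((List.range d).map fun i => a (i + 1)) := by
  induction d generalizing M a with
  | zero => exact .nil R M
  | succ d ih =>
    rw [List.range_succ_eq_map, List.map_cons, List.map_map, isWeaklyRegular_cons_iff] at h ⊢
    have hs : ∀ m : M, (a (0 + 1) - z * a 0) • m = a (0 + 1) • m := fun m => by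
      rw [sub_smul, mul_smul, ha, smul_zero, sub_zero]
    have hr : IsSMulRegular M (a (0 + 1)) := fun x y hxy => h.1 (by simpa only [hs] using hxy)
    refine ⟨hr, ih (fun i => a (i + 1)) ?_ ?_⟩
    · exact fun m => (QuotSMulTop.mem_annihilator (M := M) (a (0 + 1)) |>
        Module.mem_annihilator.mp) m
    · have heq : (a (0 + 1) - z * a 0) • (⊤ : Submodule R M) = a (0 + 1) • ⊤ := by
        ext m
        simp only [Submodule.mem_smul_pointwise_iff_exists, hs]
      exact ((Submodule.quotEquivOfEq _ _ heq).isWeaklyRegular_congr _).mp h.2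

theorem supportDim_add_length_le [IsNoetherianRing R] {M : Type*} [AddCommGroup M] [Module R M]
    [Module.Finite R M] (rs : List R) (h : IsWeaklyRegular M rs) :
    Module.supportDim R (M ⧸ (Ideal.ofList rs • ⊤ : Submodule R M)) + rs.length ≤
      Module.supportDim R M := by
  induction rs generalizing M with
  | nil =>
    simpa using Module.supportDim_le_of_surjective _
      (Submodule.mkQ_surjective (Ideal.ofList [] • ⊤ : Submodule R M))
  | cons r rs ih =>
    rw [isWeaklyRegular_cons_iff] at h
    have h₁ := Module.supportDim_quotSMulTop_succ_le_of_notMem_minimalPrimes (M := M) (x := r)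
      fun _ => h.1.notMem_of_mem_minimalPrimes
    refine le_trans ?_ h₁
    rw [Module.supportDim_eq_of_equiv
      (Submodule.quotOfListConsSMulTopEquivQuotSMulTopInner M r rs), List.length_cons,
      Nat.cast_succ, ← add_assoc]
    gcongr
    exact ih h.2

end RegularSequences

section CompleteSymmetric

variable {A B : Type*} [CommRing A] [CommRing B] {d : ℕ}

/-- The complete homogeneous symmetric polynomial of degree `k` evaluated at a finite family
`v`, as the coefficient of `T ^ k` in `∏ i, 1 / (1 - v i * T)`. -/
def completeSymm (v : Fin d → A) (k : ℕ) : A :=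
  PowerSeries.coeff k (∏ i, PowerSeries.mk fun m => v i ^ m)

theorem map_completeSymm (f : A →+* B) (v : Fin d → A) (k : ℕ) :
    f (completeSymm v k) = completeSymm (fun i => f (v i)) k := by
  rw [completeSymm, ← PowerSeries.coeff_map, map_prod, completeSymm]
  congr 2 with i m
  simp

theorem completeSymm_zero (v : Fin d → A) : completeSymm v 0 = 1 := by
  simp [completeSymm, PowerSeries.coeff_zero_eq_constantCoeff, map_prod,
    ← PowerSeries.coeff_zero_eq_constantCoeff_apply]

theorem completeSymm_cons (z : A) (v : Fin d → A) (k : ℕ) :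
    completeSymm (Fin.cons z v : Fin (d + 1) → A) (k + 1) =
      completeSymm v (k + 1) + z * completeSymm (Fin.cons z v : Fin (d + 1) → A) k := by
  have hz : (PowerSeries.mk fun m => z ^ m) =
      1 + PowerSeries.C z * ((PowerSeries.mk fun m => z ^ m) * PowerSeries.X) := by
    ext (_ | m)
    · simp
    · simp [PowerSeries.coeff_succ_mul_X, PowerSeries.coeff_one, pow_succ']
  simp only [completeSymm, Fin.prod_univ_succ, Fin.cons_zero, Fin.cons_succ]
  conv_lhs => rw [hz, add_mul, one_mul, mul_assoc, mul_right_comm, map_add,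
    PowerSeries.coeff_C_mul, PowerSeries.coeff_succ_mul_X]

theorem completeSymm_comp {n : ℕ} (e : Fin d → Fin n) (he : Function.Injective e)
    (w : Fin d → A) (v : Fin n → A) (hv : ∀ i, v (e i) = w i)
    (hv' : ∀ i, i ∉ Set.range e → v i = 0) (k : ℕ) :
    completeSymm v k = completeSymm w k := by
  rw [completeSymm, completeSymm, Fintype.prod_of_injective e he _
    (fun i => PowerSeries.mk fun m => v i ^ m)]
  · intro i hi
    ext (_ | m)
    · simp
    · simp [hv' i hi, PowerSeries.coeff_one]
  · intro i
    simp [hv]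

theorem completeSymm_mem (I : Ideal A) (v : Fin d → A) (hv : ∀ i, v i ∈ I) (k : ℕ) :
    completeSymm v (k + 1) ∈ I := by
  rw [← Ideal.Quotient.eq_zero_iff_mem, map_completeSymm,
    completeSymm_comp (d := 0) Fin.elim0 (fun i => i.elim0) Fin.elim0 _ (fun i => i.elim0)
      fun i _ => Ideal.Quotient.eq_zero_iff_mem.mpr (hv i)]
  simp [completeSymm, PowerSeries.coeff_one]

theorem monic_completeSymm_cons_X (v : Fin d → A) (k : ℕ) :
    (completeSymm (Fin.cons Polynomial.X fun i => Polynomial.C (v i) :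
      Fin (d + 1) → Polynomial A) k).Monic := by
  nontriviality A
  induction k with
  | zero => rw [completeSymm_zero]; exact Polynomial.monic_one
  | succ k ih =>
    rw [completeSymm_cons, ← map_completeSymm]
    refine (Polynomial.monic_X.mul ih).add_of_right (Polynomial.degree_C_le.trans_lt ?_)
    rw [ih.degree_mul, Polynomial.degree_X,
      Polynomial.degree_eq_natDegree ih.ne_zero]
    exact_mod_cast Nat.add_pos_left one_pos _

theorem isWeaklyRegular_completeSymm_X (R : Type*) [CommRing R] (d s : ℕ) :
    IsWeaklyRegular (MvPolynomial (Fin d) R) ((List.range d).map fun i =>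
      completeSymm (X : Fin d → MvPolynomial (Fin d) R) (s + i)) := by
  induction d generalizing s with
  | zero => exact .nil _ _
  | succ d ih =>
    set w : Fin (d + 1) → Polynomial (MvPolynomial (Fin d) R) :=
      Fin.cons Polynomial.X fun i => Polynomial.C (X i) with hw
    have hwX : ∀ k, finSuccEquiv R d (completeSymm X k) = completeSymm w k := fun k => by
      have := map_completeSymm (finSuccEquiv R d).toRingEquiv.toRingHom (X : Fin (d + 1) → _) k
      refine this.trans ?_
      congr 1
      funext i
      refine Fin.cases ?_ (fun j => ?_) i
      · exact finSuccEquiv_X_zero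
      · exact finSuccEquiv_X_succ
    rw [AddEquiv.isWeaklyRegular_congr (e := (finSuccEquiv R d).toAddEquiv)
      (bs := (List.range (d + 1)).map fun i => completeSymm w (s + i))]
    swap
    · rw [List.forall₂_map_left_iff, List.forall₂_map_right_iff]
      refine List.forall₂_same.mpr fun i _ x => ?_
      change finSuccEquiv R d (completeSymm X (s + i) * x) = _
      rw [map_mul, hwX]
      rfl
    have hmonic := monic_completeSymm_cons_X (X : Fin d → MvPolynomial (Fin d) R) s
    rw [List.range_succ_eq_map, List.map_cons, List.map_map, isWeaklyRegular_cons_iff]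
    refine ⟨hmonic.isRegular.left.isSMulRegular, ?_⟩
    refine isWeaklyRegular_shift d (fun i => completeSymm w (s + i)) Polynomial.X ?_ ?_
    · exact Module.mem_annihilator.mp (QuotSMulTop.mem_annihilator _ _)
    have hrec : ∀ i, completeSymm w (s + (i + 1)) - Polynomial.X * completeSymm w (s + i) =
        algebraMap _ _ (completeSymm (X : Fin d → MvPolynomial (Fin d) R) (s + 1 + i)) := by
      intro i
      rw [← add_assoc, completeSymm_cons, add_sub_cancel_right, ← map_completeSymm,
        Polynomial.algebraMap_eq, add_right_comm]
    simp only [hrec]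
    have e : QuotSMulTop (completeSymm w (s + 0)) (Polynomial (MvPolynomial (Fin d) R))
        ≃ₗ[Polynomial (MvPolynomial (Fin d) R)]
          (Polynomial (MvPolynomial (Fin d) R) ⧸ Ideal.span {completeSymm w s}) :=
      Submodule.quotEquivOfEq _ _ (by
        rw [← Submodule.ideal_span_singleton_smul, smul_eq_mul, Ideal.mul_top, add_zero])
    have hlist : ((List.range d).map fun i => algebraMap (MvPolynomial (Fin d) R)
        (Polynomial (MvPolynomial (Fin d) R)) (completeSymm X (s + 1 + i))) =
        ((List.range d).map fun i => completeSymm X (s + 1 + i)).map (algebraMap _ _) :=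
      List.map_map.symm
    rw [e.isWeaklyRegular_congr, hlist, isWeaklyRegular_map_algebraMap_iff]
    have := hmonic.free_quotient
    rw [← isWeaklyRegular_map_algebraMap_iff
      (S := Polynomial (MvPolynomial (Fin d) R) ⧸ Ideal.span {completeSymm w s})]
    exact (ih (s + 1)).of_flat

end CompleteSymmetric

section VariableIdeals

variable {σ R : Type*} [CommRing R]

theorem ker_killCompl {τ : Type*} {f : τ → σ} (hf : Function.Injective f) :
    RingHom.ker (killCompl hf : MvPolynomial σ R →ₐ[R] MvPolynomial τ R) =
      Ideal.span (X '' (Set.range f)ᶜ) := by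
  apply le_antisymm
  · intro p hp
    rw [mem_ideal_span_X_image]
    intro m hm
    by_contra! h
    have hm' : (m.support : Set σ) ⊆ Set.range f := fun i hi => by
      by_contra hi'
      exact Finsupp.mem_support_iff.mp hi (h i hi')
    have := coeff_killCompl hf (p := p) (s := m.comapDomain f hf.injOn)
    rw [(RingHom.mem_ker).mp hp, Finsupp.mapDomain_comapDomain f hf m hm', coeff_zero] at this
    exact mem_support_iff.mp hm this.symm
  · rw [Ideal.span_le]
    rintro _ ⟨i, hi, rfl⟩
    simp only [SetLike.mem_coe, RingHom.mem_ker, killCompl, aeval_X]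
    exact dif_neg hi

theorem isPrime_span_X_image [IsDomain R] (t : Set σ) :
    (Ideal.span (X '' t : Set (MvPolynomial σ R))).IsPrime := by
  have := ker_killCompl (R := R) (Subtype.val_injective (p := (· ∈ tᶜ)))
  rw [Subtype.range_coe_subtype, Set.ofPred_mem_eq, compl_compl] at this
  rw [← this]
  exact RingHom.ker_isPrime _

theorem X_mem_span_X_image [Nontrivial R] {t : Set σ} {i : σ} :
    (X i : MvPolynomial σ R) ∈ Ideal.span (X '' t) ↔ i ∈ t := by
  refine ⟨fun h => ?_, fun h => Ideal.subset_span ⟨i, h, rfl⟩⟩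
  classical
  obtain ⟨j, hj, hij⟩ := mem_ideal_span_X_image.mp h (Finsupp.single i 1) (by simp [support_X])
  rw [Finsupp.single_apply] at hij
  split_ifs at hij with h
  · exact h ▸ hj
  · exact absurd rfl hij

theorem span_X_image_mono {s t : Set σ} (h : s ⊆ t) :
    Ideal.span (X '' s : Set (MvPolynomial σ R)) ≤ Ideal.span (X '' t) :=
  Ideal.span_mono (Set.image_mono h)

variable [IsDomain R]

theorem X_mul_mem_span_X_image {t : Set σ} {i : σ} (hi : i ∉ t) {p : MvPolynomial σ R} :
    X i * p ∈ Ideal.span (X '' t) ↔ p ∈ Ideal.span (X '' t) :=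
  ⟨fun h => ((isPrime_span_X_image t).mem_or_mem h).resolve_left (mt X_mem_span_X_image.mp hi),
    fun h => Ideal.mul_mem_left _ _ h⟩

variable [DecidableEq σ] (c : Set σ)

theorem isWeaklyRegular_quotient_iInf_star (rs : List (MvPolynomial σ R)) (a : σ) (s : Finset σ)
    (ha : a ∉ s) (hc : ∀ i ∈ s, i ∉ c)
    (h : ∀ i ∈ s, IsWeaklyRegular
      (MvPolynomial σ R ⧸ Ideal.span (X '' (insert a (insert i c)) : Set (MvPolynomial σ R))) rs) :
    IsWeaklyRegular (MvPolynomial σ R ⧸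
      ⨅ i ∈ s, Ideal.span (X '' (insert a (insert i c)) : Set (MvPolynomial σ R))) rs := by
  induction s using Finset.induction_on with
  | empty =>
    have : Subsingleton (MvPolynomial σ R ⧸ ⨅ i ∈ (∅ : Finset σ),
        Ideal.span (X '' (insert a (insert i c)) : Set (MvPolynomial σ R))) :=
      Ideal.Quotient.subsingleton_iff.mpr (by simp)
    exact isWeaklyRegular_of_subsingleton rs
  | insert b s hb ih =>
    simp only [Finset.mem_insert, not_or, forall_eq_or_imp] at ha hc h
    refine isWeaklyRegular_quotient_of_colon rs (X b) (fun p => ?_) ?_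
      (ih ha.2 hc.2 h.2) h.1
    · simp only [Submodule.mem_iInf, Finset.mem_insert, forall_eq_or_imp]
      refine ⟨fun hp i hi => (X_mul_mem_span_X_image ?_).mp (hp.2 i hi), fun hp => ⟨?_, fun i hi =>
        Ideal.mul_mem_left _ _ (hp i hi)⟩⟩
      · simp only [Set.mem_insert_iff, not_or]
        exact ⟨Ne.symm ha.1, fun hbi => hb (hbi ▸ hi), hc.1⟩
      · exact Ideal.mul_mem_right _ _ (X_mem_span_X_image.mpr (by simp))
    · apply le_antisymm
      · refine sup_le (iInf₂_le b (Finset.mem_insert_self b s)) ?_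
        rw [Ideal.span_singleton_le_iff_mem]
        exact X_mem_span_X_image.mpr (by simp)
      · rw [Ideal.span_le]
        rintro _ ⟨i, hi, rfl⟩
        obtain rfl | hi : i = b ∨ i ∈ insert a c := by
          simp only [Set.mem_insert_iff] at hi ⊢
          tauto
        · exact Ideal.mem_sup_right (Ideal.mem_span_singleton_self _)
        · refine Ideal.mem_sup_left ?_
          simp only [Submodule.mem_iInf]
          exact fun j _ => X_mem_span_X_image.mpr
            (Set.insert_subset_insert (Set.subset_insert j c) hi)

theorem exists_sub_mul_prod_X_mem (a : σ) (s : Finset σ) (ha : a ∉ s) (hc : ∀ i ∈ s, i ∉ c)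
    (p : MvPolynomial σ R) (hp : ∀ i ∈ s, p ∈ Ideal.span (X '' (insert a (insert i c)))) :
    ∃ u, p - u * ∏ i ∈ s, X i ∈ Ideal.span (X '' (insert a c)) := by
  induction s using Finset.induction_on with
  | empty => exact ⟨p, by simp⟩
  | insert b s hb ih =>
    simp only [Finset.mem_insert, not_or, forall_eq_or_imp] at ha hc hp
    obtain ⟨u, hu⟩ := ih ha.2 hc.2 hp.2
    have hmono := span_X_image_mono (R := R)
      (Set.insert_subset_insert (a := a) (Set.subset_insert b c))
    have hprime := isPrime_span_X_image (R := R) (insert a (insert b c))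
    have hmem : u * ∏ i ∈ s, X i ∈ Ideal.span (X '' (insert a (insert b c))) := by
      simpa using Ideal.sub_mem _ hp.1 (hmono hu)
    have hu' := (hprime.mem_or_mem hmem).resolve_right fun hprod => by
      obtain ⟨i, hi, hmem⟩ := hprime.prod_mem_iff.mp hprod
      rw [X_mem_span_X_image, Set.mem_insert_iff, Set.mem_insert_iff] at hmem
      rcases hmem with rfl | rfl | hmem
      · exact ha.2 hi
      · exact hb hi
      · exact hc.2 i hi hmem
    rw [Set.insert_comm, Set.image_insert_eq] at hu'
    obtain ⟨v, q, hq, rfl⟩ := Ideal.mem_span_insert.mp hu'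
    refine ⟨v, ?_⟩
    rw [Finset.prod_insert hb]
    convert Ideal.add_mem _ hu (Ideal.mul_mem_right (∏ i ∈ s, X i) _ hq) using 1
    ring

theorem isWeaklyRegular_quotient_iInf_pairs (rs : List (MvPolynomial σ R)) (s : Finset σ)
    (hc : ∀ i ∈ s, i ∉ c)
    (h : ∀ i ∈ s, ∀ j ∈ s, i ≠ j → IsWeaklyRegular
      (MvPolynomial σ R ⧸ Ideal.span (X '' (insert i (insert j c)) : Set (MvPolynomial σ R))) rs) :
    IsWeaklyRegular (MvPolynomial σ R ⧸ ⨅ i ∈ s, ⨅ j ∈ s, ⨅ _ : i ≠ j,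
      Ideal.span (X '' (insert i (insert j c)) : Set (MvPolynomial σ R))) rs := by
  induction s using Finset.induction_on with
  | empty =>
    have : Subsingleton (MvPolynomial σ R ⧸ ⨅ i ∈ (∅ : Finset σ), ⨅ j ∈ (∅ : Finset σ), ⨅ _ : i ≠ j,
        Ideal.span (X '' (insert i (insert j c)) : Set (MvPolynomial σ R))) :=
      Ideal.Quotient.subsingleton_iff.mpr (by simp)
    exact isWeaklyRegular_of_subsingleton rs
  | insert a s ha ih =>
    have hc' := fun i hi => hc i (Finset.mem_insert_of_mem hi)
    refine isWeaklyRegular_quotient_of_colon rs (X a) (fun p => ?_) ?_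
      (ih hc' fun i hi j hj => h i (Finset.mem_insert_of_mem hi) j (Finset.mem_insert_of_mem hj))
      (isWeaklyRegular_quotient_iInf_star c rs a s ha hc' fun i hi => h a
        (Finset.mem_insert_self a s) i (Finset.mem_insert_of_mem hi) fun hai => ha (hai ▸ hi))
    · simp only [Submodule.mem_iInf]
      constructor
      · intro hp i hi j hj hij
        refine (X_mul_mem_span_X_image ?_).mp
          (hp i (Finset.mem_insert_of_mem hi) j (Finset.mem_insert_of_mem hj) hij)
        simp only [Set.mem_insert_iff, not_or]
        exact ⟨fun hai => ha (hai ▸ hi), fun haj => ha (haj ▸ hj), hc a (Finset.mem_insert_self a s)⟩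
      · intro hp i hi j hj hij
        by_cases hai : a = i ∨ a = j
        · refine Ideal.mul_mem_right _ _ (X_mem_span_X_image.mpr ?_)
          simp only [Set.mem_insert_iff]
          tauto
        · rw [not_or] at hai
          exact Ideal.mul_mem_left _ _ (hp i (Finset.mem_of_mem_insert_of_ne hi (Ne.symm hai.1)) j
            (Finset.mem_of_mem_insert_of_ne hj (Ne.symm hai.2)) hij)
    · apply le_antisymm
      · refine sup_le (fun p hp => ?_) ?_
        · simp only [Submodule.mem_iInf] at hp ⊢
          exact fun i hi => hp a (Finset.mem_insert_self a s) i (Finset.mem_insert_of_mem hi)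
            fun hai => ha (hai ▸ hi)
        · rw [Ideal.span_singleton_le_iff_mem]
          simp only [Submodule.mem_iInf]
          exact fun i _ => X_mem_span_X_image.mpr (by simp)
      · intro p hp
        simp only [Submodule.mem_iInf] at hp
        obtain ⟨u, hu⟩ := exists_sub_mul_prod_X_mem c a s ha hc' p hp
        rw [← sub_add_cancel p (u * ∏ i ∈ s, X i)]
        refine Ideal.add_mem _ ?_ (Ideal.mem_sup_left (Ideal.mul_mem_left _ _ ?_))
        · refine (Ideal.span_le.mpr ?_ : Ideal.span (X '' insert a c) ≤ _) hu
          rintro _ ⟨k, rfl | hk, rfl⟩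
          · exact Ideal.mem_sup_right (Ideal.mem_span_singleton_self _)
          · refine Ideal.mem_sup_left ?_
            simp only [Submodule.mem_iInf]
            exact fun i _ j _ _ => X_mem_span_X_image.mpr (by simp [hk])
        · simp only [Submodule.mem_iInf]
          intro i hi j hj hij
          obtain ⟨k, hk, hks⟩ : ∃ k ∈ insert i (insert j c), k ∈ s := by
            by_cases hia : i = a
            · exact ⟨j, by simp, Finset.mem_of_mem_insert_of_ne hj fun hja =>
                hij (hia.trans hja.symm)⟩
            · exact ⟨i, by simp, Finset.mem_of_mem_insert_of_ne hi hia⟩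
          exact Ideal.mem_of_dvd _ (Finset.dvd_prod_of_mem _ hks) (X_mem_span_X_image.mpr hk)

end VariableIdeals

section CohenMacaulay

theorem ringKrullDim_quotient_le_of_forall_isPrime {R : Type*} [CommRing R] {I : Ideal R}
    {d : WithBot ℕ∞} (h : ∀ P : Ideal R, P.IsPrime → I ≤ P → ∃ J ≤ P, ringKrullDim (R ⧸ J) ≤ d) :
    ringKrullDim (R ⧸ I) ≤ d := by
  rw [ringKrullDim_quotient]
  refine iSup_le fun l => ?_
  obtain ⟨J, hJ, hd⟩ := h l.head.1.asIdeal l.head.1.isPrime l.head.2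
  rw [ringKrullDim_quotient] at hd
  let l' : LTSeries (PrimeSpectrum.zeroLocus (J : Set R)) :=
    { length := l.length
      toFun := fun i => ⟨(l i).1, fun _ hx => (LTSeries.head_le l i : l.head ≤ l i) (hJ hx)⟩
      step := fun i => l.step i }
  exact (le_iSup (fun l : LTSeries (PrimeSpectrum.zeroLocus (J : Set R)) =>
    (l.length : WithBot ℕ∞)) l').trans hd

variable {K : Type*} [Field K] {n : ℕ}

/-- The quotient of a polynomial ring by the variables in `t` is the polynomial ring in the
remaining variables. -/
def quotientSpanXEquiv (t : Finset (Fin n)) {d : ℕ} (hd : tᶜ.card = d) :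
    (MvPolynomial (Fin n) K ⧸ Ideal.span (X '' (t : Set (Fin n)) : Set (MvPolynomial (Fin n) K)))
      ≃ₐ[K] MvPolynomial (Fin d) K :=
  (Ideal.quotientEquivAlgOfEq K (by
      rw [ker_killCompl, Finset.range_orderEmbOfFin, Finset.coe_compl, compl_compl])).trans
    (Ideal.quotientKerAlgEquivOfSurjective (f := killCompl (tᶜ.orderEmbOfFin hd).injective)
      fun p => ⟨rename _ p, killCompl_rename_app _ p⟩)

theorem quotientSpanXEquiv_mk (t : Finset (Fin n)) {d : ℕ} (hd : tᶜ.card = d)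
    (p : MvPolynomial (Fin n) K) :
    quotientSpanXEquiv t hd (Ideal.Quotient.mk _ p) =
      killCompl (tᶜ.orderEmbOfFin hd).injective p := rfl

theorem ringKrullDim_quotient_span_X (t : Finset (Fin n)) {d : ℕ} (hd : tᶜ.card = d) :
    ringKrullDim (MvPolynomial (Fin n) K ⧸
      Ideal.span (X '' (t : Set (Fin n)) : Set (MvPolynomial (Fin n) K))) = d := by
  rw [ringKrullDim_eq_of_ringEquiv (quotientSpanXEquiv t hd).toRingEquiv,
    MvPolynomial.ringKrullDim_of_isNoetherianRing, ringKrullDim_eq_zero_of_field]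
  simp

theorem killCompl_completeSymm (t : Finset (Fin n)) {d : ℕ} (hd : tᶜ.card = d) (s : ℕ) :
    killCompl (R := K) (tᶜ.orderEmbOfFin hd).injective (completeSymm X s) = completeSymm X s := by
  have hinj := (tᶜ.orderEmbOfFin hd).injective
  refine (map_completeSymm (killCompl (R := K) hinj).toRingHom X s).trans
    (completeSymm_comp _ hinj _ _ (fun j => ?_) (fun j hj => ?_) _)
  · exact (congrArg _ (rename_X _ j).symm).trans (killCompl_rename_app hinj (X j))
  · exact (aeval_X _ j).trans (dif_neg hj)

theorem isWeaklyRegular_quotient_span_X (t : Finset (Fin n)) {d : ℕ} (hd : tᶜ.card = d) (s : ℕ) :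
    IsWeaklyRegular (MvPolynomial (Fin n) K ⧸
      Ideal.span (X '' (t : Set (Fin n)) : Set (MvPolynomial (Fin n) K)))
      ((List.range d).map fun i =>
        completeSymm (X : Fin n → MvPolynomial (Fin n) K) (s + i)) := by
  refine (AddEquiv.isWeaklyRegular_congr (e := (quotientSpanXEquiv t hd).toAddEquiv) ?_).mpr
    (isWeaklyRegular_completeSymm_X K d s)
  rw [List.forall₂_map_left_iff, List.forall₂_map_right_iff]
  refine List.forall₂_same.mpr fun i _ x => ?_
  obtain ⟨x, rfl⟩ := Ideal.Quotient.mk_surjective x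
  generalize hr : completeSymm (X : Fin n → MvPolynomial (Fin n) K) (s + i) = r
  have hsmul : r • Ideal.Quotient.mk (Ideal.span (X '' (t : Set (Fin n)))) x =
      Ideal.Quotient.mk _ (r * x) := rfl
  rw [hsmul]
  change quotientSpanXEquiv t hd _ = _ • quotientSpanXEquiv t hd _
  rw [quotientSpanXEquiv_mk, quotientSpanXEquiv_mk, map_mul, ← hr, killCompl_completeSymm,
    smul_eq_mul]

/-- The ideal `⋂ (X i, X j, X k : k ∈ c)`, the intersection ranging over the pairs of distinct
elements `i, j` of `s`, has a Cohen–Macaulay quotient. -/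
theorem cohenMacaulay_quotient_iInf_pairs (c s : Finset (Fin n)) (hsc : Disjoint s c)
    (hs : 1 < s.card) {I : Ideal (MvPolynomial (Fin n) K)}
    (hI : I = ⨅ i ∈ s, ⨅ j ∈ s, ⨅ _ : i ≠ j,
      Ideal.span (X '' (insert i (insert j (c : Set (Fin n)))))) :
    idealDepth (Ideal.span (Set.range (X : Fin n → MvPolynomial (Fin n) K)))
        (MvPolynomial (Fin n) K ⧸ I) = n - (c.card + 2) ∧
      ringKrullDim (MvPolynomial (Fin n) K ⧸ I) = ((n - (c.card + 2) : ℕ) : WithBot ℕ∞) := by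
  have hc : ∀ i ∈ s, i ∉ c := fun i hi => Finset.disjoint_left.mp hsc hi
  have hcard : ∀ i ∈ s, ∀ j ∈ s, i ≠ j → (insert i (insert j c))ᶜ.card = n - (c.card + 2) := by
    intro i hi j hj hij
    rw [Finset.card_compl, Fintype.card_fin, Finset.card_insert_of_notMem,
      Finset.card_insert_of_notMem (hc j hj)]
    simp [hij, hc i hi]
  have hle : ∀ i ∈ s, ∀ j ∈ s, i ≠ j →
      I ≤ Ideal.span (X '' (insert i (insert j (c : Set (Fin n))))) := by
    intro i hi j hj hij p hp
    simp only [hI, Submodule.mem_iInf] at hp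
    exact hp i hi j hj hij
  obtain ⟨a, ha, b, hb, hab⟩ := Finset.one_lt_card.mp hs
  have hdim : ringKrullDim (MvPolynomial (Fin n) K ⧸ I) =
      ((n - (c.card + 2) : ℕ) : WithBot ℕ∞) := by
    apply le_antisymm
    · refine ringKrullDim_quotient_le_of_forall_isPrime fun P hP hIP => ?_
      have hinf : s.offDiag.inf (fun q => Ideal.span
          (X '' (insert q.1 (insert q.2 (c : Set (Fin n)))))) ≤ P := by
        refine le_trans (fun p hp => ?_) hIP
        simp only [Submodule.mem_finsetInf, Finset.mem_offDiag, Prod.forall] at hp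
        simp only [hI, Submodule.mem_iInf]
        exact fun i hi j hj hij => hp i j ⟨hi, hj, hij⟩
      obtain ⟨⟨i, j⟩, hij, hle⟩ := hP.inf_le'.mp hinf
      obtain ⟨hi, hj, hij⟩ := Finset.mem_offDiag.mp hij
      refine ⟨_, hle, ?_⟩
      have := ringKrullDim_quotient_span_X (K := K) _ (hcard i hi j hj hij)
      rw [Finset.coe_insert, Finset.coe_insert] at this
      exact this.le
    · have := ringKrullDim_quotient_span_X (K := K) _ (hcard a ha b hb hab)
      rw [Finset.coe_insert, Finset.coe_insert] at this
      rw [← this]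
      exact ringKrullDim_le_of_surjective _ (Ideal.Quotient.factor_surjective (hle a ha b hb hab))
  refine ⟨IsGreatest.csSup_eq ⟨?_, ?_⟩, hdim⟩
  · have hmem : ∀ r ∈ (List.range (n - (c.card + 2))).map fun i =>
        completeSymm (X : Fin n → MvPolynomial (Fin n) K) (1 + i),
        r ∈ Ideal.span (Set.range (X : Fin n → MvPolynomial (Fin n) K)) := by
      intro r hr
      obtain ⟨i, -, rfl⟩ := List.mem_map.mp hr
      rw [add_comm]
      exact completeSymm_mem _ _ (fun j => Ideal.subset_span (Set.mem_range_self j)) i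
    refine ⟨_, by simp, hmem, ⟨?_, fun htop => ?_⟩⟩
    · rw [hI]
      refine isWeaklyRegular_quotient_iInf_pairs (c : Set (Fin n)) _ s hc
        fun i hi j hj hij => ?_
      have := isWeaklyRegular_quotient_span_X (K := K) _ (hcard i hi j hj hij) 1
      rwa [Finset.coe_insert, Finset.coe_insert] at this
    · have hle' : (⊤ : Submodule (MvPolynomial (Fin n) K) (MvPolynomial (Fin n) K ⧸ I)) ≤
          Submodule.map (Submodule.mkQ I)
            (Ideal.span (Set.range (X : Fin n → MvPolynomial (Fin n) K))) := by
        rw [htop]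
        refine Submodule.smul_le.mpr fun r hr x _ => ?_
        obtain ⟨x, rfl⟩ := Submodule.mkQ_surjective I x
        rw [← map_smul]
        exact Submodule.mem_map_of_mem (Ideal.mul_mem_right x _ (Ideal.span_le.mpr hmem hr))
      obtain ⟨q, hq, hq1⟩ := hle' (Submodule.mem_top (x := Submodule.mkQ I 1))
      rw [Submodule.mkQ_apply, Submodule.mkQ_apply, Submodule.Quotient.eq] at hq1
      have hprime := isPrime_span_X_image (R := K) (Set.univ : Set (Fin n))
      rw [← Set.image_univ] at hq
      refine hprime.one_notMem ?_
      convert Ideal.sub_mem _ hq (span_X_image_mono (Set.subset_univ _)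
        (hle a ha b hb hab hq1)) using 1
      ring
  · rintro k ⟨rs, rfl, -, hrs⟩
    have hlen := supportDim_add_length_le rs hrs.toIsWeaklyRegular
    rw [Module.supportDim_quotient_eq_ringKrullDim, hdim] at hlen
    have := hrs.quot_ofList_smul_nontrivial ⊤
    obtain ⟨m, hm⟩ := WithBot.ne_bot_iff_exists.mp
      (Module.supportDim_ne_bot_of_nontrivial (MvPolynomial (Fin n) K)
        ((MvPolynomial (Fin n) K ⧸ I) ⧸ (Ideal.ofList rs •
          (⊤ : Submodule (MvPolynomial (Fin n) K) (MvPolynomial (Fin n) K ⧸ I)))))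
    rw [← hm] at hlen
    have hlen' : m + (rs.length : ℕ∞) ≤ ((n - (c.card + 2) : ℕ) : ℕ∞) :=
      WithBot.coe_le_coe.mp hlen
    exact_mod_cast le_add_self.trans hlen'

theorem iInf_lt_eq_iInf_pairs (c : Set (Fin n)) (F : Fin n → Fin n → Ideal (MvPolynomial (Fin n) K))
    (hF : ∀ i j, F i j = Ideal.span (X '' (insert i (insert j c)))) :
    ⨅ (i : Fin n) (j : Fin n) (_ : 0 < (i : ℕ)) (_ : i < j), F i j =
      ⨅ i ∈ Finset.univ.filter fun i : Fin n => 0 < (i : ℕ),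
        ⨅ j ∈ Finset.univ.filter fun i : Fin n => 0 < (i : ℕ), ⨅ _ : i ≠ j,
          Ideal.span (X '' (insert i (insert j c))) := by
  ext p
  simp only [hF, Submodule.mem_iInf, Finset.mem_filter, Finset.mem_univ, true_and]
  refine ⟨fun h i hi j hj hij => ?_, fun h i j hi hij =>
    h i hi j (hi.trans (Fin.lt_def.mp hij)) hij.ne⟩
  rcases hij.lt_or_gt with hlt | hlt
  · exact h i j hi hlt
  · rw [Set.insert_comm]
    exact h j i hj hlt

end CohenMacaulay

/-- In `S = K[x₁,…,xₙ]` (`n ≥ 3`), `S/T'_{1,n}` is Cohen–Macaulay of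
dimension `n-2` and `S/T_{1,n}` is Cohen–Macaulay of dimension `n-3`, where
`T'_{1,n} = ⋂_{2 ≤ i < j ≤ n} (xᵢ, xⱼ)` and `T_{1,n} = ⋂_{2 ≤ i < j ≤ n} (x₁, xᵢ, xⱼ)`
(Cohen–Macaulay means depth with respect to the maximal graded ideal equals Krull
dimension). -/
theorem T1n_cohenMacaulay {K : Type*} [Field K] (n : ℕ) (hn : 3 ≤ n) :
    (idealDepth (Ideal.span (Set.range (X : Fin n → MvPolynomial (Fin n) K)))
        (MvPolynomial (Fin n) K ⧸
          ⨅ (i : Fin n) (j : Fin n) (_ : 0 < (i : ℕ)) (_ : i < j),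
            Ideal.span {(X i : MvPolynomial (Fin n) K), X j}) = n - 2 ∧
      ringKrullDim (MvPolynomial (Fin n) K ⧸
          ⨅ (i : Fin n) (j : Fin n) (_ : 0 < (i : ℕ)) (_ : i < j),
            Ideal.span {(X i : MvPolynomial (Fin n) K), X j}) =
        ((n - 2 : ℕ) : WithBot (WithTop ℕ))) ∧
    (idealDepth (Ideal.span (Set.range (X : Fin n → MvPolynomial (Fin n) K)))
        (MvPolynomial (Fin n) K ⧸
          ⨅ (i : Fin n) (j : Fin n) (_ : 0 < (i : ℕ)) (_ : i < j),
            Ideal.span {(X (⟨0, by omega⟩ : Fin n) : MvPolynomial (Fin n) K), X i, X j}) =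
        n - 3 ∧
      ringKrullDim (MvPolynomial (Fin n) K ⧸
          ⨅ (i : Fin n) (j : Fin n) (_ : 0 < (i : ℕ)) (_ : i < j),
            Ideal.span {(X (⟨0, by omega⟩ : Fin n) : MvPolynomial (Fin n) K), X i, X j}) =
        ((n - 3 : ℕ) : WithBot (WithTop ℕ))) := by
  have hs : 1 < (Finset.univ.filter fun i : Fin n => 0 < (i : ℕ)).card :=
    Finset.one_lt_card.mpr ⟨⟨1, by omega⟩, by simp, ⟨2, by omega⟩, by simp, by simp⟩
  refine ⟨cohenMacaulay_quotient_iInf_pairs ∅ _ (Finset.disjoint_empty_right _) hs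
    (iInf_lt_eq_iInf_pairs _ _ fun i j => ?_),
    cohenMacaulay_quotient_iInf_pairs {⟨0, by omega⟩} _ (by simp) hs
      (iInf_lt_eq_iInf_pairs _ _ fun i j => ?_)⟩
  · simp [Set.image_insert_eq]
  · rw [Finset.coe_singleton, Set.image_insert_eq, Set.image_insert_eq, Set.image_singleton,
      Set.insert_comm, Set.pair_comm, Set.insert_comm]
end
end

section
/- Let C ≠ C_{n,d} be a d-uniform clutter on [n] and let e be a simplicial submaximal circuit of C. Set C' = C \ e := {F ∈ C : e ⊄ F}, and let I = I(C̄) and J = I(C̄') be the circuit ideals of the complements. Then reg(I) = reg(J). -/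
open MvPolynomial

noncomputable section

/-- A graded free resolution of the ideal `I` over the polynomial ring `K[xᵢ : i ∈ σ]`:
the `i`-th free module has rank `b i`, its `k`-th standard generator sits in degree
`deg i k`; `aug` is the augmentation map onto `I` and `d i` are the differentials.
All maps are graded (matrix entries are homogeneous of the appropriate degrees) and the
complex is exact. -/
def IsGradedFreeResolution {sig K : Type*} [Field K]
    (I : Ideal (MvPolynomial sig K)) (b : ℕ → ℕ) (deg : (i : ℕ) → Fin (b i) → ℕ)
    (aug : (Fin (b 0) → MvPolynomial sig K) →ₗ[MvPolynomial sig K] MvPolynomial sig K)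
    (d : (i : ℕ) → ((Fin (b (i + 1)) → MvPolynomial sig K) →ₗ[MvPolynomial sig K]
      (Fin (b i) → MvPolynomial sig K))) : Prop :=
  LinearMap.range aug = I ∧
  (∀ k, (aug (Pi.single k 1)).IsHomogeneous (deg 0 k)) ∧
  (∀ i k l, (d i) (Pi.single k 1) l = 0 ∨
    ∃ e, deg i l + e = deg (i + 1) k ∧ ((d i) (Pi.single k 1) l).IsHomogeneous e) ∧
  LinearMap.ker aug = LinearMap.range (d 0) ∧
  (∀ i, LinearMap.ker (d i) = LinearMap.range (d (i + 1)))

/-- `I` has a `q`-linear resolution: `I` has a graded free resolution in which the `i`-th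
free module is generated entirely in degree `q + i`.  (Equivalently, `I` is generated in
degree `q` and `β_{i,j}(I) = 0` whenever `j ≠ i + q`.) -/
def HasLinearResolution {sig K : Type*} [Field K] (q : ℕ)
    (I : Ideal (MvPolynomial sig K)) : Prop :=
  ∃ b deg aug d, IsGradedFreeResolution I b deg aug d ∧ ∀ i k, deg i k = q + i

/-- The Castelnuovo–Mumford regularity of `I`: the least `r` admitting a graded free
resolution of `I` whose `i`-th free module is generated in degrees `≤ r + i`.
(Equivalently, `reg I = sup { j - i : β_{i,j}(I) ≠ 0 }`.) -/
noncomputable def idealReg {sig K : Type*} [Field K] (I : Ideal (MvPolynomial sig K)) : ℕ :=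
  sInf {r : ℕ | ∃ b deg aug d, IsGradedFreeResolution I b deg aug d ∧ ∀ i k, deg i k ≤ r + i}

/-- The circuit ideal of a clutter `C` on `[n]`: the ideal generated by the square-free
monomials `x_F = ∏_{i ∈ F} x_i` for the circuits `F ∈ C`. -/
noncomputable def circuitIdeal {n : ℕ} (K : Type*) [Field K]
    (C : Finset (Finset (Fin n))) : Ideal (MvPolynomial (Fin n) K) :=
  Ideal.span ((fun F => ∏ i ∈ F, (MvPolynomial.X i : MvPolynomial (Fin n) K)) '' ↑C)

/-- The complement of a `d`-uniform clutter `C` on `[n]` inside the maximal `d`-uniform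
clutter `C_{n,d}` of all `d`-subsets of `[n]`. -/
def clutterCompl {n : ℕ} (d : ℕ) (C : Finset (Finset (Fin n))) : Finset (Finset (Fin n)) :=
  Finset.powersetCard d (Finset.univ : Finset (Fin n)) \ C

universe u

section GradedFamilies

variable {K : Type u} [Field K] {σ : Type}

/-- The elements of internal degree `t` in the free module of rank one whose generator sits in
degree `a`. -/
def shiftedHomogeneous (K : Type u) [Field K] (σ : Type) (a t : ℕ) : Set (MvPolynomial σ K) :=
  {p | p = 0 ∨ ∃ e, a + e = t ∧ p.IsHomogeneous e}

/-- The elements of degree `t` in the graded free module with generators in degrees `deg`. -/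
def freeDegree (K : Type u) [Field K] (σ : Type) {ι : Type} (deg : ι → ℕ) (t : ℕ) :
    Set (ι → MvPolynomial σ K) :=
  {v | ∀ l, v l ∈ shiftedHomogeneous K σ (deg l) t}

/-- The degree `t` part of an ideal whose degrees are shifted by `a`. -/
def idealDegree (I : Ideal (MvPolynomial σ K)) (a t : ℕ) : Set (MvPolynomial σ K) :=
  {p | p ∈ I ∧ p ∈ shiftedHomogeneous K σ a t}

variable {M : Type u} [AddCommGroup M] [Module (MvPolynomial σ K) M]
  {M' : Type u} [AddCommGroup M'] [Module (MvPolynomial σ K) M']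

/-- The degree `t` part of the kernel of a map. -/
def kerDegree (H : ℕ → Set M) (g : M →ₗ[MvPolynomial σ K] M') (t : ℕ) : Set M :=
  {m | m ∈ H t ∧ g m = 0}

variable (K σ) in
/-- A family `H` of subsets of `M` whose members are the degree parts of a graded submodule. -/
structure IsGradedFamily {M : Type u} [AddCommGroup M] [Module (MvPolynomial σ K) M]
    (H : ℕ → Set M) : Prop where
  zero_mem : ∀ t, 0 ∈ H t
  add_mem : ∀ t x y, x ∈ H t → y ∈ H t → x + y ∈ H t
  smul_mem : ∀ e t (p : MvPolynomial σ K) x, p.IsHomogeneous e → x ∈ H t → p • x ∈ H (t + e)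

/-- The graded free module with generators in degrees `deg` maps onto `H`, degree by degree. -/
def IsGradedCover {ι : Type} (deg : ι → ℕ)
    (φ : (ι → MvPolynomial σ K) →ₗ[MvPolynomial σ K] M) (H : ℕ → Set M) : Prop :=
  ∀ t, φ '' freeDegree K σ deg t = H t

/-- `H` has a graded free resolution whose `i`-th module is generated in degrees `≤ r + i`. -/
def HasBoundedResolution (K : Type u) [Field K] (σ : Type) {M : Type u} [AddCommGroup M]
    [Module (MvPolynomial σ K) M] (r : ℕ) (H : ℕ → Set M) : Prop :=
  ∃ (b : ℕ → ℕ) (deg : (i : ℕ) → Fin (b i) → ℕ)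
    (aug : (Fin (b 0) → MvPolynomial σ K) →ₗ[MvPolynomial σ K] M)
    (δ : (i : ℕ) → ((Fin (b (i + 1)) → MvPolynomial σ K) →ₗ[MvPolynomial σ K]
      (Fin (b i) → MvPolynomial σ K))),
    (∀ i k, deg i k ≤ r + i) ∧ IsGradedCover (deg 0) aug H ∧
    IsGradedCover (deg 1) (δ 0) (kerDegree (freeDegree K σ (deg 0)) aug) ∧
    ∀ i, IsGradedCover (deg (i + 2)) (δ (i + 1)) (kerDegree (freeDegree K σ (deg (i + 1))) (δ i))

lemma shiftedHomogeneous_zero (a t : ℕ) : (0 : MvPolynomial σ K) ∈ shiftedHomogeneous K σ a t :=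
  Or.inl rfl

lemma isGradedFamily_shiftedHomogeneous (a : ℕ) :
    IsGradedFamily K σ (shiftedHomogeneous K σ a) where
  zero_mem := shiftedHomogeneous_zero a
  add_mem := by
    rintro t x y (rfl | ⟨e, he, hx⟩) hy
    · simpa using hy
    · rcases hy with rfl | ⟨e', he', hy⟩
      · exact Or.inr ⟨e, he, by simpa using hx⟩
      · obtain rfl : e = e' := by omega
        exact Or.inr ⟨e, he, hx.add hy⟩
  smul_mem := by
    rintro e t p x hp (rfl | ⟨e', he', hx⟩)
    · simpa using shiftedHomogeneous_zero _ _
    · exact Or.inr ⟨e + e', by omega, hp.mul hx⟩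

lemma isGradedFamily_freeDegree {ι : Type} (deg : ι → ℕ) :
    IsGradedFamily K σ (freeDegree K σ deg) where
  zero_mem t l := (isGradedFamily_shiftedHomogeneous (deg l)).zero_mem t
  add_mem t _ _ hx hy l :=
    (isGradedFamily_shiftedHomogeneous (deg l)).add_mem t _ _ (hx l) (hy l)
  smul_mem e t p _ hp hx l :=
    (isGradedFamily_shiftedHomogeneous (deg l)).smul_mem e t p _ hp (hx l)

lemma isGradedFamily_idealDegree (I : Ideal (MvPolynomial σ K)) (a : ℕ) :
    IsGradedFamily K σ (idealDegree I a) where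
  zero_mem t := ⟨I.zero_mem, shiftedHomogeneous_zero a t⟩
  add_mem t _ _ hx hy :=
    ⟨I.add_mem hx.1 hy.1, (isGradedFamily_shiftedHomogeneous a).add_mem t _ _ hx.2 hy.2⟩
  smul_mem e t p _ hp hx :=
    ⟨I.mul_mem_left _ hx.1, (isGradedFamily_shiftedHomogeneous a).smul_mem e t p _ hp hx.2⟩

lemma IsGradedFamily.kerDegree {H : ℕ → Set M} (hH : IsGradedFamily K σ H)
    (g : M →ₗ[MvPolynomial σ K] M') : IsGradedFamily K σ (kerDegree H g) where
  zero_mem t := ⟨hH.zero_mem t, map_zero g⟩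
  add_mem t _ _ hx hy := ⟨hH.add_mem t _ _ hx.1 hy.1, by rw [map_add, hx.2, hy.2, add_zero]⟩
  smul_mem e t p _ hp hx := ⟨hH.smul_mem e t p _ hp hx.1, by rw [map_smul, hx.2, smul_zero]⟩

lemma IsGradedFamily.prod {H : ℕ → Set M} {H' : ℕ → Set M'} (hH : IsGradedFamily K σ H)
    (hH' : IsGradedFamily K σ H') : IsGradedFamily K σ (fun t => H t ×ˢ H' t) where
  zero_mem t := ⟨hH.zero_mem t, hH'.zero_mem t⟩
  add_mem t _ _ hx hy := ⟨hH.add_mem t _ _ hx.1 hy.1, hH'.add_mem t _ _ hx.2 hy.2⟩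
  smul_mem e t p _ hp hx := ⟨hH.smul_mem e t p _ hp hx.1, hH'.smul_mem e t p _ hp hx.2⟩

lemma IsGradedFamily.sub_mem {H : ℕ → Set M} (hH : IsGradedFamily K σ H) {t : ℕ} {x y : M}
    (hx : x ∈ H t) (hy : y ∈ H t) : x - y ∈ H t := by
  have h := hH.smul_mem 0 t (C (-1)) y (isHomogeneous_C _ _) hy
  have h' : (C (-1) : MvPolynomial σ K) • y = -y := by simp
  rw [h'] at h
  simpa [sub_eq_add_neg] using hH.add_mem t _ _ hx h

lemma IsGradedFamily.sum_mem {H : ℕ → Set M} (hH : IsGradedFamily K σ H) {t : ℕ} {ι : Type}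
    (s : Finset ι) (f : ι → M) (hf : ∀ i ∈ s, f i ∈ H t) : ∑ i ∈ s, f i ∈ H t :=
  Finset.sum_induction f (· ∈ H t) (hH.add_mem t) (hH.zero_mem t) hf

lemma map_eq_sum_single {ι : Type} [Fintype ι] [DecidableEq ι]
    (φ : (ι → MvPolynomial σ K) →ₗ[MvPolynomial σ K] M) (v : ι → MvPolynomial σ K) :
    φ v = ∑ l, v l • φ (Pi.single l 1) := by
  conv_lhs => rw [← Finset.univ_sum_single v]
  rw [map_sum]
  refine Finset.sum_congr rfl fun l _ => ?_
  rw [← map_smul, ← Pi.single_smul, smul_eq_mul, mul_one]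

lemma IsGradedFamily.map_mem {ι : Type} [Fintype ι] [DecidableEq ι] {H : ℕ → Set M}
    (hH : IsGradedFamily K σ H) {deg : ι → ℕ}
    {φ : (ι → MvPolynomial σ K) →ₗ[MvPolynomial σ K] M}
    (hφ : ∀ k, φ (Pi.single k 1) ∈ H (deg k)) {t : ℕ} {v : ι → MvPolynomial σ K}
    (hv : v ∈ freeDegree K σ deg t) : φ v ∈ H t := by
  rw [map_eq_sum_single]
  refine hH.sum_mem _ _ fun l _ => ?_
  rcases hv l with h | ⟨e, rfl, h⟩
  · rw [h, zero_smul]; exact hH.zero_mem t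
  · exact hH.smul_mem e _ _ _ h (hφ l)

lemma single_mem_freeDegree {ι : Type} [DecidableEq ι] (deg : ι → ℕ) (k : ι) :
    (Pi.single k 1 : ι → MvPolynomial σ K) ∈ freeDegree K σ deg (deg k) := by
  intro l
  by_cases h : l = k
  · subst h
    exact Or.inr ⟨0, rfl, by simpa using isHomogeneous_one σ K⟩
  · exact Or.inl (Pi.single_eq_of_ne h _)

lemma IsGradedCover.single_mem {ι : Type} [DecidableEq ι] {deg : ι → ℕ} {H : ℕ → Set M}
    {φ : (ι → MvPolynomial σ K) →ₗ[MvPolynomial σ K] M} (hφ : IsGradedCover deg φ H) (k : ι) :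
    φ (Pi.single k 1) ∈ H (deg k) := by
  rw [← hφ]; exact ⟨_, single_mem_freeDegree deg k, rfl⟩

lemma IsGradedFamily.isGradedCover {ι : Type} [Fintype ι] [DecidableEq ι] {H : ℕ → Set M}
    (hH : IsGradedFamily K σ H) {deg : ι → ℕ}
    {φ : (ι → MvPolynomial σ K) →ₗ[MvPolynomial σ K] M}
    (hφ : ∀ k, φ (Pi.single k 1) ∈ H (deg k))
    (hs : ∀ t, ∀ m ∈ H t, ∃ v ∈ freeDegree K σ deg t, φ v = m) : IsGradedCover deg φ H := by
  intro t
  refine Set.Subset.antisymm ?_ (hs t)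
  rintro _ ⟨v, hv, rfl⟩
  exact hH.map_mem hφ hv

/-- The shape of a predicate on graded families that is closed under taking syzygies. -/
def ClosedUnderSyzygies
    (Q : ℕ → ∀ (M : Type u) [AddCommGroup M] [Module (MvPolynomial σ K) M], (ℕ → Set M) → Prop) :
    Prop :=
  ∀ (r : ℕ) (M : Type u) [AddCommGroup M] [Module (MvPolynomial σ K) M] (H : ℕ → Set M),
    Q r M H → ∃ (ι : Type) (_ : Finite ι) (deg : ι → ℕ)
      (φ : (ι → MvPolynomial σ K) →ₗ[MvPolynomial σ K] M),
      (∀ k, deg k ≤ r) ∧ IsGradedCover deg φ H ∧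
        Q (r + 1) (ι → MvPolynomial σ K) (kerDegree (freeDegree K σ deg) φ)

/-- A stage in the construction of a resolution. -/
structure SyzygyStage
    (Q : ℕ → ∀ (M : Type u) [AddCommGroup M] [Module (MvPolynomial σ K) M], (ℕ → Set M) → Prop)
    where
  bound : ℕ
  rank : ℕ
  deg : Fin rank → ℕ
  syz : ℕ → Set (Fin rank → MvPolynomial σ K)
  prop : Q bound (Fin rank → MvPolynomial σ K) syz

lemma HasBoundedResolution.of_fin_step
    {Q : ℕ → ∀ (M : Type u) [AddCommGroup M] [Module (MvPolynomial σ K) M], (ℕ → Set M) → Prop}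
    (hQ : ∀ (r : ℕ) (M : Type u) [AddCommGroup M] [Module (MvPolynomial σ K) M] (H : ℕ → Set M),
      Q r M H → ∃ (b : ℕ) (deg : Fin b → ℕ)
        (φ : (Fin b → MvPolynomial σ K) →ₗ[MvPolynomial σ K] M),
        (∀ k, deg k ≤ r) ∧ IsGradedCover deg φ H ∧
          Q (r + 1) (Fin b → MvPolynomial σ K) (kerDegree (freeDegree K σ deg) φ))
    {r : ℕ} {H : ℕ → Set M} (h : Q r M H) : HasBoundedResolution K σ r H := by
  classical
  choose b deg φ hdeg hφ hker using hQ
  let next : SyzygyStage Q → SyzygyStage Q := fun s =>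
    ⟨s.bound + 1, b _ _ _ s.prop, deg _ _ _ s.prop, _, hker _ _ _ s.prop⟩
  let stage : ℕ → SyzygyStage Q := fun i =>
    Nat.rec ⟨r + 1, b _ _ _ h, deg _ _ _ h, _, hker _ _ _ h⟩ (fun _ s => next s) i
  have hb : ∀ i, (stage i).bound = r + i + 1 := by
    intro i
    induction i with
    | zero => rfl
    | succ i ih =>
      change (stage i).bound + 1 = _
      omega
  refine ⟨fun i => (stage i).rank, fun i => (stage i).deg, φ _ _ _ h,
    fun i => φ _ _ _ (stage i).prop, ?_, hφ _ _ _ h, hφ _ _ _ (stage 0).prop,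
    fun i => hφ _ _ _ (stage (i + 1)).prop⟩
  intro i k
  cases i with
  | zero => exact hdeg _ _ _ h k
  | succ i =>
    exact (hdeg _ _ _ (stage i).prop k).trans_eq (hb i)

lemma HasBoundedResolution.of_closedUnderSyzygies
    {Q : ℕ → ∀ (M : Type u) [AddCommGroup M] [Module (MvPolynomial σ K) M], (ℕ → Set M) → Prop}
    (hQ : ClosedUnderSyzygies Q) {r : ℕ} {H : ℕ → Set M} (h : Q r M H) :
    HasBoundedResolution K σ r H := by
  refine HasBoundedResolution.of_fin_step (Q := fun r M _ _ H =>
    ∃ (M₀ : Type u) (_ : AddCommGroup M₀) (_ : Module (MvPolynomial σ K) M₀) (H₀ : ℕ → Set M₀)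
      (f : M₀ ≃ₗ[MvPolynomial σ K] M), (∀ t, f '' H₀ t = H t) ∧ Q r M₀ H₀) ?_
    ⟨M, _, _, H, LinearEquiv.refl _ _, fun t => Set.image_id _, h⟩
  rintro r M _ _ H ⟨M₀, _, _, H₀, f, hf, h₀⟩
  obtain ⟨ι, _, deg, φ, hdeg, hφ, hker⟩ := hQ r M₀ H₀ h₀
  obtain ⟨b, ⟨ε⟩⟩ := Finite.exists_equiv_fin ι
  let L : (ι → MvPolynomial σ K) ≃ₗ[MvPolynomial σ K] (Fin b → MvPolynomial σ K) :=
    LinearEquiv.funCongrLeft _ _ ε.symm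
  have hL : ∀ t v, L v ∈ freeDegree K σ (deg ∘ ε.symm) t ↔ v ∈ freeDegree K σ deg t := by
    intro t v
    exact (ε.symm.forall_congr_right (q := fun l => v l ∈ shiftedHomogeneous K σ (deg l) t))
  refine ⟨b, deg ∘ ε.symm, f.toLinearMap ∘ₗ φ ∘ₗ L.symm.toLinearMap, fun k => hdeg _, ?_,
    _, _, _, _, L, ?_, hker⟩
  · intro t
    rw [← hf, ← hφ]
    ext m
    constructor
    · rintro ⟨v, hv, rfl⟩
      obtain ⟨w, rfl⟩ := L.surjective v
      exact ⟨φ w, ⟨w, (hL t w).1 hv, rfl⟩, by simp⟩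
    · rintro ⟨_, ⟨w, hw, rfl⟩, rfl⟩
      exact ⟨L w, (hL t w).2 hw, by simp⟩
  · intro t
    ext v
    obtain ⟨w, rfl⟩ := L.surjective v
    constructor
    · rintro ⟨w', hw', h⟩
      obtain rfl := L.injective h
      exact ⟨(hL t _).2 hw'.1, by simp [hw'.2]⟩
    · rintro ⟨h₁, h₂⟩
      exact ⟨w, ⟨(hL t _).1 h₁, by simpa using h₂⟩, rfl⟩

lemma HasBoundedResolution.exists_cover {r : ℕ} {H : ℕ → Set M}
    (h : HasBoundedResolution K σ r H) :
    ∃ (b : ℕ) (deg : Fin b → ℕ) (φ : (Fin b → MvPolynomial σ K) →ₗ[MvPolynomial σ K] M),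
      (∀ k, deg k ≤ r) ∧ IsGradedCover deg φ H ∧
        HasBoundedResolution K σ (r + 1) (kerDegree (freeDegree K σ deg) φ) := by
  obtain ⟨b, deg, aug, δ, h₁, h₂, h₃, h₄⟩ := h
  refine ⟨b 0, deg 0, aug, h₁ 0, h₂, fun i => b (i + 1), fun i => deg (i + 1), δ 0,
    fun i => δ (i + 1), fun i k => ?_, h₃, h₄ 0, fun i => h₄ (i + 1)⟩
  exact (h₁ (i + 1) k).trans_eq (by omega)

lemma HasBoundedResolution.of_cover {r : ℕ} {H : ℕ → Set M} {ι : Type} [Finite ι]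
    {deg : ι → ℕ} {φ : (ι → MvPolynomial σ K) →ₗ[MvPolynomial σ K] M} (hdeg : ∀ k, deg k ≤ r)
    (hφ : IsGradedCover deg φ H)
    (h : HasBoundedResolution K σ (r + 1) (kerDegree (freeDegree K σ deg) φ)) :
    HasBoundedResolution K σ r H := by
  refine HasBoundedResolution.of_closedUnderSyzygies (Q := fun r M _ _ H =>
    ∃ (ι : Type) (_ : Finite ι) (deg : ι → ℕ)
      (φ : (ι → MvPolynomial σ K) →ₗ[MvPolynomial σ K] M),
      (∀ k, deg k ≤ r) ∧ IsGradedCover deg φ H ∧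
        HasBoundedResolution K σ (r + 1) (kerDegree (freeDegree K σ deg) φ)) ?_
    ⟨ι, ‹_›, deg, φ, hdeg, hφ, h⟩
  rintro r M _ _ H ⟨ι, _, deg, φ, hdeg, hφ, h⟩
  obtain ⟨b, deg', φ', h'⟩ := h.exists_cover
  exact ⟨ι, ‹_›, deg, φ, hdeg, hφ, Fin b, inferInstance, deg', φ', h'⟩

lemma HasBoundedResolution.mono {r s : ℕ} (hrs : r ≤ s) {H : ℕ → Set M}
    (h : HasBoundedResolution K σ r H) :
    HasBoundedResolution K σ s H := by
  obtain ⟨b, deg, aug, δ, h₁, h₂⟩ := h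
  exact ⟨b, deg, aug, δ, fun i k => (h₁ i k).trans (by omega), h₂⟩

lemma HasBoundedResolution.map {r : ℕ} {H : ℕ → Set M} {H' : ℕ → Set M'}
    (h : HasBoundedResolution K σ r H) (f : M →ₗ[MvPolynomial σ K] M')
    (hf : ∀ t, f '' H t = H' t) (hinj : ∀ t, ∀ m ∈ H t, f m = 0 → m = 0) :
    HasBoundedResolution K σ r H' := by
  obtain ⟨b, deg, φ, hdeg, hφ, hker⟩ := h.exists_cover
  refine HasBoundedResolution.of_cover (φ := f ∘ₗ φ) hdeg ?_ ?_
  · intro t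
    rw [← hf, ← hφ, Set.image_image]
    rfl
  · convert hker using 1
    ext t v
    refine and_congr_right fun hv => ⟨fun h => ?_, fun h => ?_⟩
    · exact hinj t _ (by rw [← hφ]; exact ⟨v, hv, rfl⟩) h
    · simp [h]

lemma hasBoundedResolution_zero (r : ℕ) :
    HasBoundedResolution K σ r (fun _ => ({0} : Set M)) := by
  refine HasBoundedResolution.of_closedUnderSyzygies (Q := fun _ _ _ _ H => ∀ t, H t = {0}) ?_
    (fun _ => rfl)
  intro r M _ _ H h
  refine ⟨Empty, inferInstance, Empty.elim, 0, fun k => k.elim, fun t => ?_, fun t => ?_⟩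
  · rw [h]
    refine Set.Subset.antisymm ?_ ?_
    · rintro _ ⟨v, -, rfl⟩
      rfl
    · rintro _ rfl
      exact ⟨0, fun l => l.elim, rfl⟩
  · refine Set.eq_singleton_iff_unique_mem.2 ⟨⟨fun l => l.elim, rfl⟩, fun v _ => ?_⟩
    exact Subsingleton.elim _ _

/-- Extensions of graded modules with bounded resolutions have bounded resolutions
(horseshoe lemma). -/
lemma HasBoundedResolution.extension {r : ℕ} {H : ℕ → Set M} {H' : ℕ → Set M'}
    (g : M →ₗ[MvPolynomial σ K] M') (hH : IsGradedFamily K σ H) (hg : ∀ t, g '' H t = H' t)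
    (hX : HasBoundedResolution K σ r (kerDegree H g)) (hZ : HasBoundedResolution K σ r H') :
    HasBoundedResolution K σ r H := by
  classical
  refine HasBoundedResolution.of_closedUnderSyzygies (Q := fun r M _ _ H =>
    IsGradedFamily K σ H ∧ ∃ (M' : Type u) (_ : AddCommGroup M') (_ : Module (MvPolynomial σ K) M')
      (H' : ℕ → Set M') (g : M →ₗ[MvPolynomial σ K] M'), (∀ t, g '' H t = H' t) ∧
      HasBoundedResolution K σ r (kerDegree H g) ∧ HasBoundedResolution K σ r H') ?_
    ⟨hH, M', _, _, H', g, hg, hX, hZ⟩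
  clear hX hZ hg hH g H' H
  rintro r M _ _ H ⟨hH, M', _, _, H', g, hg, hX, hZ⟩
  obtain ⟨b, degX, φX, hdegX, hφX, hkerX⟩ := hX.exists_cover
  obtain ⟨c, degZ, φZ, hdegZ, hφZ, hkerZ⟩ := hZ.exists_cover
  have hlift : ∀ k, ∃ y ∈ H (degZ k), g y = φZ (Pi.single k 1) := fun k => by
    have := hφZ.single_mem k
    rwa [← hg] at this
  choose y hy hgy using hlift
  let ψ : (Fin c → MvPolynomial σ K) →ₗ[MvPolynomial σ K] M := Fintype.linearCombination _ y
  have hψ1 : ∀ k, ψ (Pi.single k 1) = y k := fun k => by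
    simp [ψ, Fintype.linearCombination_apply_single]
  have hψ : ∀ {t v}, v ∈ freeDegree K σ degZ t → ψ v ∈ H t := fun hv =>
    hH.map_mem (fun k => by rw [hψ1]; exact hy k) hv
  have hgψ : ∀ v, g (ψ v) = φZ v := fun v => by
    rw [map_eq_sum_single φZ, map_eq_sum_single ψ, map_sum]
    simp [hψ1, hgy]
  have hX' : ∀ {t v}, v ∈ freeDegree K σ degX t → φX v ∈ kerDegree H g t := fun hv => by
    rw [← hφX]; exact ⟨_, hv, rfl⟩
  let E : (Fin b ⊕ Fin c → MvPolynomial σ K) ≃ₗ[MvPolynomial σ K]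
    (Fin b → MvPolynomial σ K) × (Fin c → MvPolynomial σ K) :=
    LinearEquiv.sumArrowLequivProdArrow _ _ _ _
  have hE : ∀ t v, v ∈ freeDegree K σ (Sum.elim degX degZ) t ↔
      (E v).1 ∈ freeDegree K σ degX t ∧ (E v).2 ∈ freeDegree K σ degZ t :=
    fun t v => Sum.forall
  let φ := (φX.coprod ψ) ∘ₗ E.toLinearMap
  have hφ : ∀ v, φ v = φX (E v).1 + ψ (E v).2 := fun v => rfl
  refine ⟨Fin b ⊕ Fin c, inferInstance, Sum.elim degX degZ, φ,
    Sum.forall.2 ⟨hdegX, hdegZ⟩, fun t => Set.Subset.antisymm ?_ ?_,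
    (isGradedFamily_freeDegree _).kerDegree _, _, _, _,
    kerDegree (freeDegree K σ degZ) φZ,
    LinearMap.snd _ _ _ ∘ₗ E.toLinearMap, ?_, ?_, hkerZ⟩
  · rintro _ ⟨v, hv, rfl⟩
    have := (hE t v).1 hv
    rw [hφ]
    exact hH.add_mem t _ _ (hX' this.1).1 (hψ this.2)
  · intro m hm
    have hgm : g m ∈ H' t := by rw [← hg]; exact ⟨m, hm, rfl⟩
    rw [← hφZ] at hgm
    obtain ⟨w, hw, hwm⟩ := hgm
    have hd : m - ψ w ∈ kerDegree H g t :=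
      ⟨hH.sub_mem hm (hψ hw), by rw [map_sub, hgψ, hwm, sub_self]⟩
    rw [← hφX] at hd
    obtain ⟨u, hu, hum⟩ := hd
    refine ⟨E.symm (u, w), (hE t _).2 (by simpa using ⟨hu, hw⟩), ?_⟩
    rw [hφ]
    simp [hum]
  · intro t
    refine Set.Subset.antisymm ?_ ?_
    · rintro _ ⟨v, ⟨hv, hv0⟩, rfl⟩
      have := (hE t v).1 hv
      refine ⟨this.2, ?_⟩
      have h0 := congrArg g hv0
      rw [hφ, map_add, (hX' this.1).2, hgψ, zero_add, map_zero] at h0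
      exact h0
    · rintro w ⟨hw, hw0⟩
      have hd : 0 - ψ w ∈ kerDegree H g t :=
        ⟨hH.sub_mem (hH.zero_mem t) (hψ hw), by rw [map_sub, hgψ, hw0, map_zero, sub_self]⟩
      rw [← hφX] at hd
      obtain ⟨u, hu, hum⟩ := hd
      refine ⟨E.symm (u, w), ⟨(hE t _).2 (by simpa using ⟨hu, hw⟩), ?_⟩, by simp⟩
      rw [hφ]
      simp [hum]
  · refine hkerX.map (E.symm.toLinearMap ∘ₗ LinearMap.inl _ _ _) (fun t => ?_) ?_
    · refine Set.Subset.antisymm ?_ ?_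
      · rintro _ ⟨u, ⟨hu, hu0⟩, rfl⟩
        refine ⟨⟨(hE t _).2 ?_, ?_⟩, by simp⟩
        · simpa using ⟨hu, (isGradedFamily_freeDegree degZ).zero_mem t⟩
        · rw [hφ]
          simp [hu0]
      · rintro v ⟨⟨hv, hv0⟩, hv1⟩
        have hv2 : (E v).2 = 0 := hv1
        rw [hφ, hv2, map_zero, add_zero] at hv0
        refine ⟨(E v).1, ⟨((hE t v).1 hv).1, hv0⟩, E.injective ?_⟩
        simp only [LinearMap.comp_apply, LinearEquiv.coe_coe, LinearEquiv.apply_symm_apply,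
          LinearMap.inl_apply]
        rw [← hv2]
    · intro t u _ h
      simpa using h

/-- Quotients of graded modules with bounded resolutions by a submodule with bounded resolution
(mapping cone). -/
lemma HasBoundedResolution.quotient {r : ℕ} {H : ℕ → Set M} {H' : ℕ → Set M'}
    (g : M →ₗ[MvPolynomial σ K] M') (hg : ∀ t, g '' H t = H' t)
    (hX : HasBoundedResolution K σ (r + 1) (kerDegree H g))
    (hY : HasBoundedResolution K σ r H) :
    HasBoundedResolution K σ r H' := by
  obtain ⟨b, deg, φ, hdeg, hφ, hker⟩ := hY.exists_cover
  refine HasBoundedResolution.of_cover (φ := g ∘ₗ φ) hdeg ?_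
    (HasBoundedResolution.extension φ ((isGradedFamily_freeDegree _).kerDegree _)
      (H' := kerDegree H g) ?_ ?_ hX)
  · intro t
    rw [← hg, ← hφ, Set.image_image]
    rfl
  · intro t
    refine Set.Subset.antisymm ?_ ?_
    · rintro _ ⟨v, ⟨hv, hv0⟩, rfl⟩
      exact ⟨by rw [← hφ]; exact ⟨v, hv, rfl⟩, hv0⟩
    · rintro m ⟨hm, hm0⟩
      rw [← hφ] at hm
      obtain ⟨v, hv, rfl⟩ := hm
      exact ⟨v, ⟨hv, hm0⟩, rfl⟩
  · convert hker using 1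
    ext t v
    refine ⟨fun h => ⟨h.1.1, h.2⟩, fun h => ⟨⟨h.1, ?_⟩, h.2⟩⟩
    rw [LinearMap.comp_apply, h.2, map_zero]

lemma HasBoundedResolution.prod {r : ℕ} {H : ℕ → Set M} {H' : ℕ → Set M'}
    (hH : IsGradedFamily K σ H) (hH' : IsGradedFamily K σ H')
    (h : HasBoundedResolution K σ r H) (h' : HasBoundedResolution K σ r H') :
    HasBoundedResolution K σ r (fun t => H t ×ˢ H' t) := by
  refine HasBoundedResolution.extension (LinearMap.snd (MvPolynomial σ K) M M') (hH.prod hH')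
    (fun t => ?_) (h.map (LinearMap.inl (MvPolynomial σ K) M M') (fun t => ?_) ?_) h'
  · exact Set.snd_image_prod ⟨0, hH.zero_mem t⟩ _
  · ext ⟨x, y⟩
    constructor
    · rintro ⟨z, hz, h⟩
      obtain ⟨rfl, rfl⟩ := Prod.ext_iff.1 h
      exact ⟨⟨hz, hH'.zero_mem t⟩, rfl⟩
    · rintro ⟨hz, h⟩
      obtain rfl : y = 0 := h
      exact ⟨x, hz.1, rfl⟩
  · intro t m _ h
    simpa using h

lemma hasBoundedResolution_top (a : ℕ) :
    HasBoundedResolution K σ a (idealDegree (⊤ : Ideal (MvPolynomial σ K)) a) := by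
  refine HasBoundedResolution.of_cover (ι := Unit) (deg := fun _ => a)
    (φ := LinearMap.proj ()) (fun _ => le_rfl) (fun t => ?_) ?_
  · refine Set.Subset.antisymm ?_ ?_
    · rintro _ ⟨v, hv, rfl⟩
      exact ⟨trivial, hv ()⟩
    · rintro p ⟨-, hp⟩
      exact ⟨fun _ => p, fun _ => hp, rfl⟩
  · convert hasBoundedResolution_zero (K := K) (σ := σ) (M := Unit → MvPolynomial σ K) (a + 1)
      using 1
    ext t v
    constructor
    · rintro ⟨-, hv⟩
      funext l
      exact hv
    · rintro rfl
      exact ⟨(isGradedFamily_freeDegree _).zero_mem t, rfl⟩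

/-- The maps `c t` are the projections of `M` onto its degree parts `H t`. -/
structure HasComponents {M : Type u} [AddCommGroup M] (H : ℕ → Set M) (c : ℕ → M →+ M) :
    Prop where
  mem : ∀ t m, c t m ∈ H t
  self : ∀ t m, m ∈ H t → c t m = m
  of_ne : ∀ s t m, s ≠ t → m ∈ H s → c t m = 0
  exists_sum : ∀ m, ∃ N, ∀ T, N ≤ T → ∑ t ∈ Finset.range T, c t m = m

lemma HasComponents.map_component {H : ℕ → Set M} {c : ℕ → M →+ M} {H' : ℕ → Set M'}
    {c' : ℕ → M' →+ M'} (hc : HasComponents H c) (hc' : HasComponents H' c')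
    (f : M →ₗ[MvPolynomial σ K] M') (hf : ∀ t, ∀ m ∈ H t, f m ∈ H' t) (t : ℕ) (m : M) :
    f (c t m) = c' t (f m) := by
  obtain ⟨N, hN⟩ := hc.exists_sum m
  conv_rhs => rw [← hN (N + t + 1) (by omega)]
  rw [map_sum, map_sum, Finset.sum_eq_single t]
  · exact (hc'.self _ _ (hf _ _ (hc.mem t m))).symm
  · intro s _ hs
    exact hc'.of_ne s t _ hs (hf _ _ (hc.mem s m))
  · intro h
    exact absurd (Finset.mem_range.2 (by omega)) h

/-- The projection onto the degree `t` part of the free module generated in degree `a`. -/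
def shiftedComponent (K : Type u) [Field K] (σ : Type) (a t : ℕ) :
    MvPolynomial σ K →+ MvPolynomial σ K :=
  if a ≤ t then (homogeneousComponent (t - a)).toAddMonoidHom else 0

lemma shiftedComponent_of_le {a t : ℕ} (h : a ≤ t) (p : MvPolynomial σ K) :
    shiftedComponent K σ a t p = homogeneousComponent (t - a) p := by
  simp [shiftedComponent, h]

lemma shiftedComponent_of_lt {a t : ℕ} (h : t < a) (p : MvPolynomial σ K) :
    shiftedComponent K σ a t p = 0 := by
  rw [shiftedComponent, if_neg (by omega), AddMonoidHom.zero_apply]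

lemma sum_shiftedComponent (a : ℕ) (p : MvPolynomial σ K) {T : ℕ} (hT : a + p.totalDegree + 1 ≤ T) :
    ∑ t ∈ Finset.range T, shiftedComponent K σ a t p = p := by
  obtain ⟨k, rfl⟩ := Nat.exists_eq_add_of_le hT
  rw [add_assoc, add_assoc, Finset.sum_range_add, Finset.sum_eq_zero, zero_add,
    ← add_assoc, Finset.sum_range_add]
  · conv_rhs => rw [← sum_homogeneousComponent p]
    rw [Finset.sum_eq_zero (s := Finset.range k), add_zero]
    · refine Finset.sum_congr rfl fun t _ => ?_
      rw [shiftedComponent_of_le (by omega), Nat.add_sub_cancel_left]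
    · intro t _
      rw [shiftedComponent_of_le (by omega), homogeneousComponent_eq_zero]
      omega
  · intro t ht
    exact shiftedComponent_of_lt (Finset.mem_range.1 ht) p

lemma hasComponents_shiftedHomogeneous (a : ℕ) :
    HasComponents (shiftedHomogeneous K σ a) (shiftedComponent K σ a) where
  mem t p := by
    rcases le_or_gt a t with h | h
    · rw [shiftedComponent_of_le h]
      exact Or.inr ⟨t - a, by omega, homogeneousComponent_isHomogeneous _ _⟩
    · rw [shiftedComponent_of_lt h]
      exact shiftedHomogeneous_zero a t
  self := by
    rintro t p (rfl | ⟨e, rfl, hp⟩)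
    · exact map_zero _
    · rw [shiftedComponent_of_le (by omega), Nat.add_sub_cancel_left,
        homogeneousComponent_eq_self hp]
  of_ne := by
    rintro s t p hst (rfl | ⟨e, rfl, hp⟩)
    · exact map_zero _
    · rcases le_or_gt a t with h | h
      · rw [shiftedComponent_of_le h, homogeneousComponent_of_mem hp, if_neg (by omega)]
      · exact shiftedComponent_of_lt h p
  exists_sum p := ⟨_, fun _ h => sum_shiftedComponent a p h⟩

lemma hasComponents_freeDegree {ι : Type} [Fintype ι] (deg : ι → ℕ) :
    HasComponents (freeDegree K σ deg)
      (fun t => AddMonoidHom.pi fun l => (shiftedComponent K σ (deg l) t).comp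
        (Pi.evalAddMonoidHom _ l)) where
  mem t v l := (hasComponents_shiftedHomogeneous (deg l)).mem t (v l)
  self t v hv := funext fun l => (hasComponents_shiftedHomogeneous (deg l)).self t (v l) (hv l)
  of_ne s t v hst hv :=
    funext fun l => (hasComponents_shiftedHomogeneous (deg l)).of_ne s t (v l) hst (hv l)
  exists_sum v := by
    refine ⟨∑ l, (deg l + (v l).totalDegree + 1), fun T hT => ?_⟩
    funext l
    rw [Finset.sum_apply]
    refine sum_shiftedComponent (deg l) (v l) (le_trans ?_ hT)
    exact Finset.single_le_sum (f := fun l => deg l + (v l).totalDegree + 1)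
      (fun _ _ => Nat.zero_le _) (Finset.mem_univ l)

/-- An ideal closed under taking homogeneous components. -/
def IsHomogeneousIdeal (I : Ideal (MvPolynomial σ K)) : Prop :=
  ∀ p ∈ I, ∀ k, homogeneousComponent k p ∈ I

lemma IsHomogeneousIdeal.shiftedComponent_mem {I : Ideal (MvPolynomial σ K)}
    (hI : IsHomogeneousIdeal I) (a t : ℕ) {p : MvPolynomial σ K} (hp : p ∈ I) :
    shiftedComponent K σ a t p ∈ I := by
  rcases le_or_gt a t with h | h
  · rw [shiftedComponent_of_le h]
    exact hI p hp _
  · rw [shiftedComponent_of_lt h]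
    exact I.zero_mem

lemma isHomogeneousIdeal_span {G : Set (MvPolynomial σ K)}
    (hG : ∀ g ∈ G, ∃ e, g.IsHomogeneous e) : IsHomogeneousIdeal (Ideal.span G) := by
  let _ := MvPolynomial.gradedAlgebra (σ := σ) (R := K)
  intro p hp k
  have := Ideal.homogeneous_span (homogeneousSubmodule σ K) G hG k hp
  rwa [← decomposition.decompose'_apply p k]

section MayerVietoris

variable {I L P : Ideal (MvPolynomial σ K)} {x : MvPolynomial σ K} {a q r : ℕ}

lemma map_isGradedFamily_sup (hI : IsHomogeneousIdeal I) (hL : IsHomogeneousIdeal L)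
    (hx : x.IsHomogeneous q) (t : ℕ) :
    (LinearMap.id.coprod (LinearMap.lsmul (MvPolynomial σ K) (MvPolynomial σ K) x)) ''
      (idealDegree I a t ×ˢ idealDegree L (a + q) t) =
      idealDegree (I ⊔ Ideal.span {x} * L) a t := by
  have hmul : ∀ t, ∀ p ∈ shiftedHomogeneous K σ (a + q) t,
      LinearMap.lsmul (MvPolynomial σ K) (MvPolynomial σ K) x p ∈ shiftedHomogeneous K σ a t := by
    rintro t p (rfl | ⟨e, he, hp⟩)
    · rw [map_zero]
      exact shiftedHomogeneous_zero a t
    · exact Or.inr ⟨q + e, by omega, hx.mul hp⟩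
  refine Set.Subset.antisymm ?_ ?_
  · rintro _ ⟨⟨i, m⟩, ⟨hi, hm⟩, rfl⟩
    refine ⟨Submodule.mem_sup.2 ⟨i, hi.1, x * m, ?_, rfl⟩,
      (isGradedFamily_shiftedHomogeneous a).add_mem t _ _ hi.2 (hmul t _ hm.2)⟩
    exact Ideal.mem_span_singleton_mul.2 ⟨m, hm.1, rfl⟩
  · rintro p ⟨hp, hpt⟩
    obtain ⟨i, hi, y, hy, rfl⟩ := Submodule.mem_sup.1 hp
    obtain ⟨m, hm, rfl⟩ := Ideal.mem_span_singleton_mul.1 hy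
    refine ⟨(shiftedComponent K σ a t i, shiftedComponent K σ (a + q) t m),
      ⟨⟨hI.shiftedComponent_mem a t hi, (hasComponents_shiftedHomogeneous a).mem t i⟩,
      ⟨hL.shiftedComponent_mem (a + q) t hm,
        (hasComponents_shiftedHomogeneous (a + q)).mem t m⟩⟩, ?_⟩
    rw [LinearMap.coprod_apply, LinearMap.id_apply,
      (hasComponents_shiftedHomogeneous (a + q)).map_component
        (hasComponents_shiftedHomogeneous a) _ hmul, ← map_add]
    exact (hasComponents_shiftedHomogeneous a).self t _ hpt

lemma hasBoundedResolution_kerDegree_sup (hx : x.IsHomogeneous q)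
    (hP : ∀ s, s ∈ P ↔ s ∈ L ∧ x * s ∈ I)
    (h : HasBoundedResolution K σ r (idealDegree P (a + q))) :
    HasBoundedResolution K σ r
      (kerDegree (fun t => idealDegree I a t ×ˢ idealDegree L (a + q) t)
        (LinearMap.id.coprod (LinearMap.lsmul (MvPolynomial σ K) (MvPolynomial σ K) x))) := by
  refine h.map ((LinearMap.lsmul (MvPolynomial σ K) (MvPolynomial σ K) (-x)).prod LinearMap.id)
    (fun t => Set.Subset.antisymm ?_ ?_) (fun t m _ h => (Prod.ext_iff.1 h).2)
  · rintro _ ⟨s, ⟨hs, hst⟩, rfl⟩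
    obtain ⟨hsL, hsI⟩ := (hP s).1 hs
    refine ⟨⟨⟨?_, ?_⟩, hsL, hst⟩, ?_⟩
    · simpa using hsI
    · rcases hst with rfl | ⟨e, he, hs⟩
      · exact Or.inl (by simp)
      · exact Or.inr ⟨q + e, by omega, hx.neg.mul hs⟩
    · simp
  · rintro ⟨i, m⟩ ⟨⟨hi, hm⟩, h0⟩
    have h0' : i + x * m = 0 := h0
    have him : i = -(x * m) := eq_neg_of_add_eq_zero_left h0'
    refine ⟨m, ⟨(hP m).2 ⟨hm.1, ?_⟩, hm.2⟩, Prod.ext ?_ rfl⟩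
    · have := I.neg_mem hi.1
      rwa [him, neg_neg] at this
    · simp [him]

/-- From bounded resolutions of `I`, `L` and `P = L ∩ (I : x)` to one of `I + x L`. -/
lemma HasBoundedResolution.sup_mul (hI : IsHomogeneousIdeal I) (hL : IsHomogeneousIdeal L)
    (hx : x.IsHomogeneous q) (hP : ∀ s, s ∈ P ↔ s ∈ L ∧ x * s ∈ I)
    (h₁ : HasBoundedResolution K σ r (idealDegree I a))
    (h₂ : HasBoundedResolution K σ r (idealDegree L (a + q)))
    (h₃ : HasBoundedResolution K σ (r + 1) (idealDegree P (a + q))) :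
    HasBoundedResolution K σ r (idealDegree (I ⊔ Ideal.span {x} * L) a) :=
  HasBoundedResolution.quotient _ (map_isGradedFamily_sup hI hL hx)
    (hasBoundedResolution_kerDegree_sup hx hP h₃)
    (HasBoundedResolution.prod (isGradedFamily_idealDegree I a)
      (isGradedFamily_idealDegree L (a + q)) h₁ h₂)

/-- From bounded resolutions of `I + x L`, `L` and `P = L ∩ (I : x)` to one of `I`. -/
lemma HasBoundedResolution.of_sup_mul (hI : IsHomogeneousIdeal I) (hL : IsHomogeneousIdeal L)
    (hx : x.IsHomogeneous q) (hP : ∀ s, s ∈ P ↔ s ∈ L ∧ x * s ∈ I)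
    (h₁ : HasBoundedResolution K σ r (idealDegree (I ⊔ Ideal.span {x} * L) a))
    (h₂ : HasBoundedResolution K σ (r + 1) (idealDegree L (a + q)))
    (h₃ : HasBoundedResolution K σ r (idealDegree P (a + q))) :
    HasBoundedResolution K σ r (idealDegree I a) := by
  have h := HasBoundedResolution.extension _
    ((isGradedFamily_idealDegree I a).prod (isGradedFamily_idealDegree L (a + q)))
    (map_isGradedFamily_sup hI hL hx) (hasBoundedResolution_kerDegree_sup hx hP h₃) h₁
  refine HasBoundedResolution.quotient (LinearMap.fst (MvPolynomial σ K) _ _) (fun t => ?_)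
    (h₂.map (LinearMap.inr (MvPolynomial σ K) _ _) (fun t => ?_) ?_) h
  · exact Set.fst_image_prod _ ⟨0, (isGradedFamily_idealDegree L (a + q)).zero_mem t⟩
  · ext ⟨i, m⟩
    constructor
    · rintro ⟨z, hz, h⟩
      obtain ⟨rfl, rfl⟩ := Prod.ext_iff.1 h
      exact ⟨⟨(isGradedFamily_idealDegree I a).zero_mem t, hz⟩, rfl⟩
    · rintro ⟨hz, h⟩
      obtain rfl : i = 0 := h
      exact ⟨m, hz.2, rfl⟩
  · intro t m _ h
    simpa using h

end MayerVietoris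

lemma isHomogeneousIdeal_span_X (A : Set σ) :
    IsHomogeneousIdeal (Ideal.span (X '' A : Set (MvPolynomial σ K))) := by
  refine isHomogeneousIdeal_span ?_
  rintro _ ⟨i, -, rfl⟩
  exact ⟨1, isHomogeneous_X K i⟩

/-- Ideals generated by variables have linear resolutions. -/
lemma hasBoundedResolution_span_X (A : Finset σ) (a : ℕ) :
    HasBoundedResolution K σ (a + 1)
      (idealDegree (Ideal.span (X '' (A : Set σ) : Set (MvPolynomial σ K))) a) := by
  classical
  induction A using Finset.induction_on generalizing a with
  | empty =>
    convert hasBoundedResolution_zero (K := K) (σ := σ) (M := MvPolynomial σ K) (a + 1) using 1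
    ext t p
    simp only [Finset.coe_empty, Set.image_empty, Ideal.span_empty, Set.mem_singleton_iff]
    exact ⟨fun h => h.1, fun h => by rw [h]; exact (isGradedFamily_idealDegree _ a).zero_mem t⟩
  | insert c A hc ih =>
    have hins : Ideal.span (X '' ((insert c A : Finset σ) : Set σ) : Set (MvPolynomial σ K)) =
        Ideal.span (X '' (A : Set σ)) ⊔ Ideal.span {X c} * ⊤ := by
      rw [Finset.coe_insert, Set.image_insert_eq, Ideal.span_insert, Ideal.mul_top, sup_comm]
    rw [hins]
    refine HasBoundedResolution.sup_mul (q := 1) (isHomogeneousIdeal_span_X _)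
      (fun _ _ _ => trivial) (isHomogeneous_X K c) (fun s => ?_) (ih a)
      (hasBoundedResolution_top (a + 1)) (ih (a + 1))
    refine ⟨fun h => ⟨trivial, Ideal.mul_mem_left _ _ h⟩, fun ⟨_, h⟩ => ?_⟩
    rw [mem_ideal_span_X_image] at h ⊢
    intro m hm
    obtain ⟨i, hi, him⟩ := h (Finsupp.single c 1 + m) (by
      rw [support_X_mul]
      exact Finset.mem_map.2 ⟨m, hm, rfl⟩)
    refine ⟨i, hi, ?_⟩
    have hic : c ≠ i := by
      rintro rfl
      exact hc hi
    simpa [Finsupp.single_eq_of_ne hic.symm] using him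

lemma exists_freeDegree_of_mem_range {b : ℕ} {deg : Fin b → ℕ}
    {φ : (Fin b → MvPolynomial σ K) →ₗ[MvPolynomial σ K] M} {H : ℕ → Set M} {c : ℕ → M →+ M}
    (hH : IsGradedFamily K σ H) (hc : HasComponents H c)
    (hφ : ∀ k, φ (Pi.single k 1) ∈ H (deg k)) {t : ℕ} {m : M} (hm : m ∈ H t)
    (hr : m ∈ LinearMap.range φ) : ∃ v ∈ freeDegree K σ deg t, φ v = m := by
  obtain ⟨v, rfl⟩ := hr
  refine ⟨_, (hasComponents_freeDegree deg).mem t v, ?_⟩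
  rw [(hasComponents_freeDegree deg).map_component hc φ (fun t m hm => hH.map_mem hφ hm)]
  exact hc.self t _ hm

lemma isGradedCover_kerDegree_iff {b b' : ℕ} {deg : Fin b → ℕ} {deg' : Fin b' → ℕ}
    {φ : (Fin b' → MvPolynomial σ K) →ₗ[MvPolynomial σ K] (Fin b → MvPolynomial σ K)}
    {ψ : (Fin b → MvPolynomial σ K) →ₗ[MvPolynomial σ K] M} {H : ℕ → Set M} {c : ℕ → M →+ M}
    (hH : IsGradedFamily K σ H) (hc : HasComponents H c)
    (hψ : ∀ k, ψ (Pi.single k 1) ∈ H (deg k)) :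
    IsGradedCover deg' φ (kerDegree (freeDegree K σ deg) ψ) ↔
      (∀ k, φ (Pi.single k 1) ∈ freeDegree K σ deg (deg' k)) ∧
        LinearMap.ker ψ = LinearMap.range φ := by
  constructor
  · intro h
    refine ⟨fun k => (h.single_mem k).1, le_antisymm (fun v hv => ?_) ?_⟩
    · obtain ⟨N, hN⟩ := (hasComponents_freeDegree (K := K) (σ := σ) deg).exists_sum v
      rw [← hN N le_rfl]
      refine Submodule.sum_mem _ fun t _ => ?_
      have hmem : _ ∈ kerDegree (freeDegree K σ deg) ψ t :=
        ⟨(hasComponents_freeDegree deg).mem t v, by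
          rw [(hasComponents_freeDegree deg).map_component hc ψ
            (fun t m hm => hH.map_mem hψ hm), LinearMap.mem_ker.1 hv, map_zero]⟩
      rw [← h t] at hmem
      obtain ⟨w, -, hw⟩ := hmem
      exact ⟨w, hw⟩
    · rintro _ ⟨v, rfl⟩
      rw [LinearMap.mem_ker, map_eq_sum_single φ, map_sum]
      refine Finset.sum_eq_zero fun l _ => ?_
      rw [map_smul, (h.single_mem l).2, smul_zero]
  · rintro ⟨h, hker⟩
    refine ((isGradedFamily_freeDegree deg).kerDegree ψ).isGradedCover
      (fun k => ⟨h k, ?_⟩) (fun t m hm => ?_)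
    · rw [← LinearMap.mem_ker, hker]
      exact LinearMap.mem_range_self _ _
    · refine exists_freeDegree_of_mem_range (isGradedFamily_freeDegree deg)
        (hasComponents_freeDegree deg) h hm.1 ?_
      rw [← hker]
      exact hm.2

/-- Graded free resolutions of an ideal generated by homogeneous elements, degree by degree. -/
lemma hasBoundedResolution_idealDegree_iff {G : Set (MvPolynomial σ K)}
    (hG : ∀ g ∈ G, ∃ e, g.IsHomogeneous e) (r : ℕ) :
    (∃ b deg aug d, IsGradedFreeResolution (Ideal.span G) b deg aug d ∧
      ∀ i k, deg i k ≤ r + i) ↔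
      HasBoundedResolution K σ r (idealDegree (Ideal.span G) 0) := by
  have hS := isGradedFamily_shiftedHomogeneous (K := K) (σ := σ) 0
  have hc := hasComponents_shiftedHomogeneous (K := K) (σ := σ) 0
  constructor
  · rintro ⟨b, deg, aug, d, ⟨h₁, h₂, h₃, h₄, h₅⟩, hdeg⟩
    have haug : ∀ k, aug (Pi.single k 1) ∈ shiftedHomogeneous K σ 0 (deg 0 k) :=
      fun k => Or.inr ⟨_, zero_add _, h₂ k⟩
    have hd : ∀ i k, d i (Pi.single k 1) ∈ freeDegree K σ (deg i) (deg (i + 1) k) :=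
      fun i k => h₃ i k
    refine ⟨b, deg, aug, d, hdeg, ?_, ?_, fun i => ?_⟩
    · refine (isGradedFamily_idealDegree _ 0).isGradedCover (fun k => ⟨?_, haug k⟩)
        (fun t m hm => ?_)
      · rw [← h₁]
        exact LinearMap.mem_range_self _ _
      · refine exists_freeDegree_of_mem_range hS hc haug hm.2 ?_
        rw [h₁]
        exact hm.1
    · exact (isGradedCover_kerDegree_iff hS hc haug).2 ⟨hd 0, h₄⟩
    · exact (isGradedCover_kerDegree_iff (isGradedFamily_freeDegree _)
        (hasComponents_freeDegree _) (hd i)).2 ⟨hd (i + 1), h₅ i⟩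
  · rintro ⟨b, deg, aug, d, hdeg, h₁, h₂, h₃⟩
    have haug : ∀ k, aug (Pi.single k 1) ∈ shiftedHomogeneous K σ 0 (deg 0 k) :=
      fun k => (h₁.single_mem k).2
    have hd : ∀ i k, d i (Pi.single k 1) ∈ freeDegree K σ (deg i) (deg (i + 1) k) := by
      rintro (_ | i) k
      · exact (h₂.single_mem k).1
      · exact ((h₃ i).single_mem k).1
    refine ⟨b, deg, aug, d, ⟨le_antisymm ?_ (Ideal.span_le.2 fun g hg => ?_), fun k => ?_,
      hd, ?_, fun i => ?_⟩, hdeg⟩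
    · rintro _ ⟨v, rfl⟩
      rw [map_eq_sum_single]
      exact Submodule.sum_mem _ fun l _ => Submodule.smul_mem _ _ (h₁.single_mem l).1
    · obtain ⟨e, he⟩ := hG g hg
      have hmem : g ∈ idealDegree (Ideal.span G) 0 e :=
        ⟨Ideal.subset_span hg, Or.inr ⟨e, zero_add e, he⟩⟩
      rw [← h₁ e] at hmem
      obtain ⟨v, -, hv⟩ := hmem
      exact ⟨v, hv⟩
    · rcases haug k with h | ⟨e, he, h⟩
      · rw [h]
        exact isHomogeneous_zero _ _ _
      · rwa [← he, zero_add]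
    · exact ((isGradedCover_kerDegree_iff hS hc haug).1 h₂).2
    · exact ((isGradedCover_kerDegree_iff (isGradedFamily_freeDegree _)
        (hasComponents_freeDegree _) (hd i)).1 (h₃ i)).2

/-- A nonzero ideal without nonzero elements of degree less than `d` is not resolved with
bound less than `d`. -/
lemma HasBoundedResolution.le_bound {I : Ideal (MvPolynomial σ K)} {r d t : ℕ}
    (h : HasBoundedResolution K σ r (idealDegree I 0))
    (hI : ∀ p ∈ I, ∀ e, p.IsHomogeneous e → p ≠ 0 → d ≤ e) {p : MvPolynomial σ K} (hp : p ∈ I)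
    (hpt : p.IsHomogeneous t) (hp0 : p ≠ 0) : d ≤ r := by
  obtain ⟨b, deg, φ, hdeg, hφ, -⟩ := h.exists_cover
  by_contra hlt
  have hzero : ∀ k, φ (Pi.single k 1) = 0 := by
    intro k
    by_contra hk
    obtain ⟨hmem, h0 | ⟨e, he, hhom⟩⟩ := hφ.single_mem k
    · exact hk h0
    · have := hI _ hmem e hhom hk
      have := hdeg k
      omega
  have hmem : p ∈ idealDegree I 0 t := ⟨hp, Or.inr ⟨t, zero_add t, hpt⟩⟩
  rw [← hφ] at hmem
  obtain ⟨v, -, rfl⟩ := hmem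
  exact hp0 (by rw [map_eq_sum_single]; simp [hzero])

end GradedFamilies

section CircuitIdeals

variable {K : Type u} [Field K] {n : ℕ}

/-- The exponent vector of a square-free monomial. -/
def squarefreeExponent (F : Finset (Fin n)) : Fin n →₀ ℕ :=
  ∑ i ∈ F, Finsupp.single i 1

lemma squarefreeExponent_apply (F : Finset (Fin n)) (i : Fin n) :
    squarefreeExponent F i = if i ∈ F then 1 else 0 := by
  simp [squarefreeExponent, Finsupp.finsetSum_apply, Finsupp.single_apply]

lemma squarefreeExponent_le_iff {F : Finset (Fin n)} {m : Fin n →₀ ℕ} :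
    squarefreeExponent F ≤ m ↔ ∀ i ∈ F, m i ≠ 0 := by
  rw [Finsupp.le_def]
  refine forall_congr' fun i => ?_
  rw [squarefreeExponent_apply]
  split_ifs with h <;> simp [h, Nat.one_le_iff_ne_zero]

lemma prod_X_eq_monomial (F : Finset (Fin n)) :
    ∏ i ∈ F, (X i : MvPolynomial (Fin n) K) = monomial (squarefreeExponent F) 1 := by
  rw [squarefreeExponent, monomial_sum_one]
  rfl

lemma isHomogeneous_prod_X (F : Finset (Fin n)) :
    (∏ i ∈ F, (X i : MvPolynomial (Fin n) K)).IsHomogeneous F.card := by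
  simpa using IsHomogeneous.prod F (fun i => (X i : MvPolynomial (Fin n) K)) (fun _ => 1)
    (fun i _ => isHomogeneous_X K i)

lemma mem_circuitIdeal_iff {C : Finset (Finset (Fin n))} {p : MvPolynomial (Fin n) K} :
    p ∈ circuitIdeal K C ↔ ∀ m ∈ p.support, ∃ F ∈ C, ∀ i ∈ F, m i ≠ 0 := by
  have h : circuitIdeal K C =
      Ideal.span ((fun s => monomial s (1 : K)) '' (squarefreeExponent '' (C : Set _))) := by
    rw [Set.image_image]
    simp only [circuitIdeal, prod_X_eq_monomial]
  rw [h, mem_ideal_span_monomial_image]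
  simp only [Set.exists_mem_image, Finset.mem_coe, squarefreeExponent_le_iff]

lemma circuitIdeal_generators_homogeneous (C : Finset (Finset (Fin n))) :
    ∀ g ∈ (fun F => ∏ i ∈ F, (X i : MvPolynomial (Fin n) K)) '' (C : Set (Finset (Fin n))),
      ∃ e, g.IsHomogeneous e := by
  rintro _ ⟨F, -, rfl⟩
  exact ⟨F.card, isHomogeneous_prod_X F⟩

lemma prod_X_mem_circuitIdeal {C : Finset (Finset (Fin n))} {F : Finset (Fin n)} (hF : F ∈ C) :
    ∏ i ∈ F, (X i : MvPolynomial (Fin n) K) ∈ circuitIdeal K C :=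
  Ideal.subset_span ⟨F, hF, rfl⟩

/-- The generating degree of a uniform clutter bounds the regularity from below. -/
lemma HasBoundedResolution.le_of_uniform {C : Finset (Finset (Fin n))} {d r : ℕ}
    (hC : ∀ F ∈ C, F.card = d) (hne : C.Nonempty)
    (h : HasBoundedResolution K (Fin n) r (idealDegree (circuitIdeal K C) 0)) : d ≤ r := by
  obtain ⟨F, hF⟩ := hne
  refine h.le_bound (fun p hp e he hp0 => ?_) (prod_X_mem_circuitIdeal hF)
    (isHomogeneous_prod_X F) (by rw [prod_X_eq_monomial]; simp)
  obtain ⟨m, hm⟩ := support_nonempty.2 hp0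
  obtain ⟨F, hF, hFm⟩ := mem_circuitIdeal_iff.1 hp m hm
  rw [he.degree_eq_sum_deg_support hm, ← hC F hF, Finset.card_eq_sum_ones]
  calc ∑ _i ∈ F, 1 ≤ ∑ i ∈ F, m i :=
        Finset.sum_le_sum fun i hi => Nat.one_le_iff_ne_zero.2 (hFm i hi)
    _ ≤ ∑ i ∈ m.support, m i :=
        Finset.sum_le_sum_of_subset fun i hi => Finsupp.mem_support_iff.2 (hFm i hi)

/-- Removing the circuits through `e` adds `x_e · (x_c : c ∉ e)` to the ideal of the
complement. -/
lemma circuitIdeal_clutterCompl_filter {d : ℕ} {C : Finset (Finset (Fin n))}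
    {e : Finset (Fin n)} (hd : e.card + 1 = d) :
    circuitIdeal K (clutterCompl d (C.filter (fun F => ¬ e ⊆ F))) =
      circuitIdeal K (clutterCompl d C) ⊔
        Ideal.span {∏ i ∈ e, X i} * Ideal.span (X '' ((eᶜ : Finset (Fin n)) : Set (Fin n))) := by
  refine le_antisymm (Ideal.span_le.2 ?_) (sup_le (Ideal.span_mono ?_) ?_)
  · rintro _ ⟨F, hF, rfl⟩
    simp only [clutterCompl, Finset.coe_sdiff, Set.mem_sdiff, Finset.mem_coe,
      Finset.mem_powersetCard_univ, Finset.mem_filter, not_and, not_not] at hF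
    by_cases hFC : F ∈ C
    · have hsub := hF.2 hFC
      obtain ⟨c, hc⟩ : ∃ c, F \ e = {c} := by
        rw [← Finset.card_eq_one, Finset.card_sdiff_of_subset hsub]
        omega
      have hce : c ∉ e := by
        have : c ∈ F \ e := by rw [hc]; exact Finset.mem_singleton_self c
        exact (Finset.mem_sdiff.1 this).2
      have hFe : ∏ i ∈ F, (X i : MvPolynomial (Fin n) K) = (∏ i ∈ e, X i) * X c := by
        rw [← Finset.prod_sdiff hsub, hc, Finset.prod_singleton, mul_comm]
      simp only [hFe]
      exact Ideal.mem_sup_right (Ideal.mul_mem_mul (Ideal.mem_span_singleton_self _)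
        (Ideal.subset_span ⟨c, by simpa using hce, rfl⟩))
    · exact Ideal.mem_sup_left (prod_X_mem_circuitIdeal (by simp [clutterCompl, hF.1, hFC]))
  · refine Set.image_mono fun F hF => ?_
    simp only [clutterCompl, Finset.coe_sdiff, Set.mem_sdiff, Finset.mem_coe,
      Finset.mem_filter] at hF ⊢
    exact ⟨hF.1, fun h => hF.2 h.1⟩
  · rw [Ideal.span_mul_span, Ideal.span_le]
    simp only [Set.singleton_mul, Set.image_image]
    rintro _ ⟨c, hc, rfl⟩
    have hce : c ∉ e := by simpa using hc
    have hprod : (∏ i ∈ e, (X i : MvPolynomial (Fin n) K)) * X c = ∏ i ∈ insert c e, X i := by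
      rw [Finset.prod_insert hce, mul_comm]
    simp only [hprod]
    refine prod_X_mem_circuitIdeal ?_
    simp [clutterCompl, Finset.card_insert_of_notMem hce, hd]

/-- If the closed neighbourhood of `e` is a clique, then `(I : x_e)` is generated by the variables
outside of it. -/
lemma mem_span_X_compl_iff {d : ℕ} {C : Finset (Finset (Fin n))}
    {e : Finset (Fin n)} (hd : e.card + 1 = d)
    (hsimp : ∀ F : Finset (Fin n),
      F ⊆ e ∪ Finset.univ.filter (fun c => insert c e ∈ C) → F.card = d → F ∈ C)
    (s : MvPolynomial (Fin n) K) :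
    s ∈ Ideal.span (X '' (((e ∪ Finset.univ.filter (fun c => insert c e ∈ C))ᶜ :
        Finset (Fin n)) : Set (Fin n))) ↔
      s ∈ Ideal.span (X '' ((eᶜ : Finset (Fin n)) : Set (Fin n))) ∧
        (∏ i ∈ e, X i) * s ∈ circuitIdeal K (clutterCompl d C) := by
  constructor
  · refine fun hs => ⟨Ideal.span_mono (Set.image_mono ?_) hs, ?_⟩
    · exact_mod_cast Finset.compl_subset_compl.2 Finset.subset_union_left
    · refine Submodule.span_induction (p := fun s _ =>
        (∏ i ∈ e, X i) * s ∈ circuitIdeal K (clutterCompl d C)) ?_ ?_ ?_ ?_ hs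
      · rintro _ ⟨c, hc, rfl⟩
        simp only [Finset.coe_compl, Set.mem_compl_iff, Finset.mem_coe, Finset.mem_union,
          Finset.mem_filter, Finset.mem_univ, true_and, not_or] at hc
        rw [mul_comm, ← Finset.prod_insert hc.1]
        refine prod_X_mem_circuitIdeal ?_
        simp [clutterCompl, Finset.card_insert_of_notMem hc.1, hd, hc.2]
      · simp
      · intro x y _ _ hx hy
        rw [mul_add]
        exact Ideal.add_mem _ hx hy
      · intro a x _ hx
        rw [smul_eq_mul, mul_left_comm]
        exact Ideal.mul_mem_left _ _ hx
  · rintro ⟨-, hs⟩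
    rw [mem_ideal_span_X_image]
    intro m hm
    by_contra hcon
    push Not at hcon
    rw [prod_X_eq_monomial, mem_circuitIdeal_iff] at hs
    obtain ⟨F, hF, hFm⟩ := hs (squarefreeExponent e + m) (by
      rw [mem_support_iff, coeff_monomial_mul, one_mul]
      exact mem_support_iff.1 hm)
    simp only [clutterCompl, Finset.mem_sdiff, Finset.mem_powersetCard_univ] at hF
    refine hF.2 (hsimp F (fun i hi => ?_) hF.1)
    by_contra hi'
    refine hFm i hi ?_
    rw [Finsupp.add_apply, hcon i (by simpa using hi'), squarefreeExponent_apply, if_neg]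
    exact fun h => hi' (Finset.mem_union_left _ h)

end CircuitIdeals

/-- Let `C ≠ C_{n,d}` be a `d`-uniform clutter on `[n]` and `e` a simplicial
submaximal circuit of `C` (an `(d-1)`-subset contained in some circuit whose closed
neighbourhood `N[e]` is a clique).  If `C' = {F ∈ C : e ⊄ F}` then
`reg I(C̄) = reg I(C̄')`. -/
theorem reg_eq_of_simplicial_submaximal_circuit {K : Type*} [Field K] (n d : ℕ)
    (C : Finset (Finset (Fin n))) (hunif : ∀ F ∈ C, F.card = d)
    (hneq : C ≠ Finset.powersetCard d (Finset.univ : Finset (Fin n)))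
    (e : Finset (Fin n)) (hcard : e.card = d - 1) (hsub : ∃ F ∈ C, e ⊆ F)
    (hsimp : ∀ F : Finset (Fin n),
      F ⊆ e ∪ Finset.univ.filter (fun c => insert c e ∈ C) → F.card = d → F ∈ C) :
    idealReg (circuitIdeal K (clutterCompl d C)) =
      idealReg (circuitIdeal K (clutterCompl d (C.filter (fun F => ¬ e ⊆ F)))) := by
  classical
  obtain ⟨F₀, hF₀, heF₀⟩ := hsub
  have hd : e.card + 1 = d := by
    rcases Nat.eq_zero_or_pos d with rfl | h
    · refine absurd (Finset.Subset.antisymm ?_ ?_) hneq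
      · intro F hF
        exact Finset.mem_powersetCard_univ.2 (hunif F hF)
      · intro F hF
        rw [Finset.mem_powersetCard_univ, Finset.card_eq_zero] at hF
        rwa [hF, ← Finset.card_eq_zero.1 (hunif F₀ hF₀)]
    · omega
  have hne : (clutterCompl d C).Nonempty := by
    rw [clutterCompl, Finset.sdiff_nonempty]
    refine fun h => hneq (Finset.Subset.antisymm (fun F hF => ?_) h)
    exact Finset.mem_powersetCard_univ.2 (hunif F hF)
  have hne' : (clutterCompl d (C.filter (fun F => ¬ e ⊆ F))).Nonempty :=
    hne.mono (Finset.sdiff_subset_sdiff subset_rfl (Finset.filter_subset _ _))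
  have hcompl : ∀ C' : Finset (Finset (Fin n)), ∀ F ∈ clutterCompl d C', F.card = d :=
    fun C' F hF => Finset.mem_powersetCard_univ.1 (Finset.mem_sdiff.1 hF).1
  have hI := isHomogeneousIdeal_span (K := K)
    (circuitIdeal_generators_homogeneous (clutterCompl d C))
  have hL := isHomogeneousIdeal_span_X (K := K) ((eᶜ : Finset (Fin n)) : Set (Fin n))
  have hlin : ∀ {r}, d ≤ r → ∀ A : Finset (Fin n), HasBoundedResolution K (Fin n) r
      (idealDegree (Ideal.span (X '' (A : Set (Fin n)))) (0 + e.card)) :=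
    fun hr A => (hasBoundedResolution_span_X A _).mono (by omega)
  unfold idealReg
  congr 1
  ext r
  refine (hasBoundedResolution_idealDegree_iff (circuitIdeal_generators_homogeneous _) r).trans
    (Iff.trans ?_ (hasBoundedResolution_idealDegree_iff
      (circuitIdeal_generators_homogeneous _) r).symm)
  change HasBoundedResolution K (Fin n) r (idealDegree (circuitIdeal K _) 0) ↔
    HasBoundedResolution K (Fin n) r (idealDegree (circuitIdeal K _) 0)
  constructor
  · intro h
    have hr := h.le_of_uniform (hcompl C) hne
    rw [circuitIdeal_clutterCompl_filter hd]
    exact HasBoundedResolution.sup_mul hI hL (isHomogeneous_prod_X e)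
      (mem_span_X_compl_iff hd hsimp) h (hlin hr _) (hlin (by omega) _)
  · intro h
    have hr := h.le_of_uniform (hcompl _) hne'
    rw [circuitIdeal_clutterCompl_filter hd] at h
    exact HasBoundedResolution.of_sup_mul hI hL (isHomogeneous_prod_X e)
      (mem_span_X_compl_iff hd hsimp) h (hlin (by omega) _) (hlin hr _)
end
end
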